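/- arXiv:1812.07392 — 3 statements merged into one kernel-verified Lean document; each statement's English description precedes it below -/
import Mathlib

section
/- Let Λ be a right 4-Nakayama artin algebra and let M be a finitely generated indecomposable right Λ-module. Then the composition length of the socle of M satisfies l(soc(M)) ≤ 2. -/
/-! Basic definitions for (right) modules over a ring: radical, socle, length,
uniserial, local, indecomposable, `n`-factor serial, right `n`-Nakayama algebras,
Nakayama algebras and almost split sequences. -/

universe u v w

section ModuleDefs

variable (A : Type v) [Ring A] (M : Type w) [AddCommGroup M] [Module A M]

/-- The composition length of a module, i.e. the Krull dimension of its submodule lattice. -/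
noncomputable def moduleLength : WithBot ℕ∞ := Order.krullDim (Submodule A M)

/-- The radical of a module: the intersection of all its maximal submodules. -/
def moduleRad : Submodule A M := sInf {N : Submodule A M | IsCoatom N}

/-- The socle of a module: the sum of all its simple submodules. -/
def moduleSoc : Submodule A M := sSup {N : Submodule A M | IsAtom N}

variable {A M}

/-- The radical of a submodule `N`, viewed as a submodule of the ambient module. -/
def radOf (N : Submodule A M) : Submodule A M :=
  Submodule.map N.subtype (moduleRad A ↥N)

/-- The socle of a submodule `N`, viewed as a submodule of the ambient module. -/
def socOf (N : Submodule A M) : Submodule A M :=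
  Submodule.map N.subtype (moduleSoc A ↥N)

variable (A M)

/-- The iterated radical `rad^n(M)`, as a submodule of `M`. -/
def radPow : ℕ → Submodule A M
  | 0 => ⊤
  | n + 1 => radOf (radPow n)

/-- A module is uniserial if its submodules are totally ordered by inclusion. -/
def IsUniserialModule : Prop := ∀ N P : Submodule A M, N ≤ P ∨ P ≤ N

/-- A module is local if it has a unique maximal submodule. -/
def IsLocalModule : Prop := ∃! N : Submodule A M, IsCoatom N

/-- A module is colocal if its socle is a simple submodule. -/
def IsColocalModule : Prop := IsAtom (moduleSoc A M)

/-- A module is indecomposable if it is nonzero and is not the direct sum of two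
nonzero submodules. -/
def IsIndecModule : Prop :=
  Nontrivial M ∧ ∀ N P : Submodule A M, IsCompl N P → N = ⊥ ∨ P = ⊥

/-- The Loewy length of a module: the least `n` with `rad^n(M) = 0`. -/
noncomputable def loewyLength : ℕ := sInf {n : ℕ | radPow A M n = ⊥}

/-- A module `M` of length `l` is `n`-factor serial (`l ≥ n > 1`) if it is not uniserial,
`M/rad^{l-n}(M)` is uniserial and `M/rad^{l-n+1}(M)` is not uniserial. -/
def IsNFactorSerial (n : ℕ) : Prop :=
  1 < n ∧ ¬ IsUniserialModule A M ∧
  ∃ l : ℕ, moduleLength A M = l ∧ n ≤ l ∧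
    IsUniserialModule A (M ⧸ radPow A M (l - n)) ∧
    ¬ IsUniserialModule A (M ⧸ radPow A M (l - n + 1))

/-- `M` is `n`-factor serial, where `1`-factor serial means uniserial. -/
def IsFactorSerial (n : ℕ) : Prop :=
  (n = 1 ∧ IsUniserialModule A M) ∨ IsNFactorSerial A M n

end ModuleDefs

section AlgebraDefs

variable (Λ : Type u) [Ring Λ]

/-- A ring `Λ` is right `n`-Nakayama if every finitely generated indecomposable right
`Λ`-module is `i`-factor serial for some `1 ≤ i ≤ n`, and there is at least one finitely
generated indecomposable `n`-factor serial right `Λ`-module.  Right `Λ`-modules are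
realized as left `Λᵐᵒᵖ`-modules. -/
def IsRightNNakayama (n : ℕ) : Prop :=
  (∀ M : ModuleCat.{u} Λᵐᵒᵖ, Module.Finite Λᵐᵒᵖ M → IsIndecModule Λᵐᵒᵖ M →
      ∃ i, 1 ≤ i ∧ i ≤ n ∧ IsFactorSerial Λᵐᵒᵖ M i) ∧
  ∃ M : ModuleCat.{u} Λᵐᵒᵖ, Module.Finite Λᵐᵒᵖ M ∧ IsIndecModule Λᵐᵒᵖ M ∧
    IsNFactorSerial Λᵐᵒᵖ M n

/-- A ring `Λ` is a Nakayama algebra if every finitely generated indecomposable projective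
right `Λ`-module and every finitely generated indecomposable projective left `Λ`-module is
uniserial. -/
def IsNakayamaAlgebra : Prop :=
  (∀ M : ModuleCat.{u} Λᵐᵒᵖ, Module.Finite Λᵐᵒᵖ M → Module.Projective Λᵐᵒᵖ M →
      IsIndecModule Λᵐᵒᵖ M → IsUniserialModule Λᵐᵒᵖ M) ∧
  (∀ M : ModuleCat.{u} Λ, Module.Finite Λ M → Module.Projective Λ M →
      IsIndecModule Λ M → IsUniserialModule Λ M)

end AlgebraDefs

section AlmostSplit

variable {A : Type v} [Ring A]

/-- A pair of maps `f : X → Y`, `g : Y → Z` is an almost split (Auslander-Reiten) sequence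
if `0 → X → Y → Z → 0` is a non-split short exact sequence with `X` and `Z` indecomposable,
such that every homomorphism `V → Z` from a finitely generated module which is not a split
epimorphism factors through `g`. -/
def IsAlmostSplitSequence {X Y Z : Type w} [AddCommGroup X] [Module A X]
    [AddCommGroup Y] [Module A Y] [AddCommGroup Z] [Module A Z]
    (f : X →ₗ[A] Y) (g : Y →ₗ[A] Z) : Prop :=
  Function.Injective f ∧ Function.Surjective g ∧ LinearMap.range f = LinearMap.ker g ∧
  (¬ ∃ s : Z →ₗ[A] Y, g ∘ₗ s = LinearMap.id) ∧
  IsIndecModule A X ∧ IsIndecModule A Z ∧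
  ∀ V : ModuleCat.{w} A, Module.Finite A V →
    ∀ h : V →ₗ[A] Z, (¬ ∃ s : Z →ₗ[A] V, h ∘ₗ s = LinearMap.id) →
      ∃ k : V →ₗ[A] Y, g ∘ₗ k = h

end AlmostSplit

set_option linter.unusedSectionVars false

namespace SocleLength

section Basic

variable {A : Type*} [Ring A] {M N : Type*} [AddCommGroup M] [Module A M]
  [AddCommGroup N] [Module A N]

variable (A M) in
/-- The composition length as a natural number (with value `0` for infinite length). -/
noncomputable def len : ℕ := (Module.length A M).toNat

theorem len_congr (e : M ≃ₗ[A] N) : len A M = len A N := by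
  rw [len, len, e.length_eq]

variable [IsArtinianRing A] [Module.Finite A M] [Module.Finite A N]

theorem coe_len : (len A M : ℕ∞) = Module.length A M :=
  ENat.natCast_toNat Module.length_ne_top

theorem len_prod : len A (M × N) = len A M + len A N := by
  have : (len A (M × N) : ℕ∞) = (len A M + len A N : ℕ) := by
    push_cast
    rw [coe_len, coe_len, coe_len, Module.length_prod]
  exact_mod_cast this

theorem len_submodule_add_quotient (U : Submodule A M) :
    len A U + len A (M ⧸ U) = len A M := by
  have : ((len A U + len A (M ⧸ U) : ℕ) : ℕ∞) = len A M := by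
    push_cast
    rw [coe_len, coe_len, coe_len, Module.length_eq_add_of_exact U.subtype U.mkQ
      U.injective_subtype U.mkQ_surjective (LinearMap.exact_subtype_mkQ U)]
  exact_mod_cast this

theorem len_le_of_injective (f : M →ₗ[A] N) (hf : Function.Injective f) : len A M ≤ len A N := by
  have : (len A M : ℕ∞) ≤ len A N := by
    rw [coe_len, coe_len]
    exact Module.length_le_of_injective f hf
  exact_mod_cast this

theorem len_le_of_surjective (f : M →ₗ[A] N) (hf : Function.Surjective f) :
    len A N ≤ len A M := by
  have : (len A N : ℕ∞) ≤ len A M := by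
    rw [coe_len, coe_len]
    exact Module.length_le_of_surjective f hf
  exact_mod_cast this

theorem len_mono {U V : Submodule A M} (h : U ≤ V) : len A U ≤ len A V :=
  len_le_of_injective _ (Submodule.inclusion_injective h)

theorem len_lt_of_lt {U V : Submodule A M} (h : U < V) : len A U < len A V := by
  have : (len A U : ℕ∞) < len A V := by
    rw [coe_len, coe_len, Module.length_submodule, Module.length_submodule]
    exact Submodule.height_strictMono h
  exact_mod_cast this

theorem len_top : len A (⊤ : Submodule A M) = len A M := len_congr Submodule.topEquiv

theorem len_pos [Nontrivial M] : 0 < len A M := by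
  have : (0 : ℕ∞) < len A M := by
    rw [coe_len]
    exact Module.length_pos
  exact_mod_cast this

theorem len_eq_one_iff : len A M = 1 ↔ IsSimpleModule A M := by
  rw [← Module.length_eq_one_iff, ← coe_len]
  norm_cast

theorem len_ker_add_range (f : M →ₗ[A] N) :
    len A (LinearMap.ker f) + len A (LinearMap.range f) = len A M := by
  rw [← len_congr f.quotKerEquivRange, len_submodule_add_quotient]

theorem len_range_of_injective (f : M →ₗ[A] N) (hf : Function.Injective f) :
    len A (LinearMap.range f) = len A M :=
  (len_congr (LinearEquiv.ofInjective f hf)).symm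

end Basic

section Radical

variable {A : Type*} [Ring A] [IsArtinianRing A] {M N : Type*} [AddCommGroup M] [Module A M]
  [AddCommGroup N] [Module A N]

theorem isSemisimpleModule_of_jacobson_smul_eq_bot
    (h : Ring.jacobson A • (⊤ : Submodule A M) = ⊥) : IsSemisimpleModule A M := by
  have ht : Module.IsTorsionBySet A M (Ring.jacobson A) := by
    intro x a
    have : (a : A) • x ∈ Ring.jacobson A • (⊤ : Submodule A M) :=
      Submodule.smul_mem_smul a.2 trivial
    rwa [h, Submodule.mem_bot] at this
  let _ := ht.module
  exact (ht.semilinearMap.isSemisimpleModule_iff_of_bijective Function.bijective_id).2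
    inferInstance

theorem jacobson_smul_top_quotient {I : Ideal A} (U : Submodule A M) (h : I • ⊤ ≤ U) :
    I • (⊤ : Submodule A (M ⧸ U)) = ⊥ := by
  have : (⊤ : Submodule A (M ⧸ U)) = Submodule.map U.mkQ ⊤ := by simp
  rw [this, ← Submodule.map_smul'', ← le_bot_iff, Submodule.map_le_iff_le_comap]
  simpa using h

theorem isSemisimpleModule_submodule (U : Submodule A M) (h : Ring.jacobson A • U = ⊥) :
    IsSemisimpleModule A U := by
  apply isSemisimpleModule_of_jacobson_smul_eq_bot
  apply Submodule.map_injective_of_injective U.injective_subtype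
  rw [Submodule.map_smul'', Submodule.map_bot]
  simpa using h

theorem jacobson_eq_smul_top : Module.jacobson A M = Ring.jacobson A • ⊤ := by
  refine le_antisymm ?_ (Ring.jacobson_smul_top_le A M)
  have := isSemisimpleModule_of_jacobson_smul_eq_bot
    (jacobson_smul_top_quotient (Ring.jacobson A • (⊤ : Submodule A M)) le_rfl)
  exact Module.jacobson_le_of_eq_bot (IsSemisimpleModule.jacobson_eq_bot _ _)

theorem radPow_succ (k : ℕ) : radPow A M (k + 1) = Ring.jacobson A • radPow A M k := by
  change Submodule.map (radPow A M k).subtype (Module.jacobson A _) = _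
  rw [jacobson_eq_smul_top, Submodule.map_smul'']
  simp

theorem radPow_succ_le (k : ℕ) : radPow A M (k + 1) ≤ radPow A M k := by
  rw [radPow_succ]
  exact Submodule.smul_le_right

theorem radPow_antitone : Antitone (radPow A M) := antitone_nat_of_succ_le radPow_succ_le

theorem radPow_one : radPow A M 1 = Ring.jacobson A • ⊤ := radPow_succ 0

theorem map_radPow (f : M →ₗ[A] N) (hf : Function.Surjective f) (k : ℕ) :
    (radPow A M k).map f = radPow A N k := by
  induction k with
  | zero => simpa [radPow] using LinearMap.range_eq_top.2 hf
  | succ k ih => rw [radPow_succ, radPow_succ, Submodule.map_smul'', ih]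

theorem map_radPow_le (f : M →ₗ[A] N) (k : ℕ) : (radPow A M k).map f ≤ radPow A N k := by
  induction k with
  | zero => simp [radPow]
  | succ k ih =>
    rw [radPow_succ, radPow_succ, Submodule.map_smul'']
    exact smul_mono_right _ ih

theorem map_radPow_le_succ (f : M →ₗ[A] N) (h : LinearMap.range f ≤ Ring.jacobson A • ⊤) (k : ℕ) :
    (radPow A M k).map f ≤ radPow A N (k + 1) := by
  induction k with
  | zero =>
    rw [zero_add, radPow_one]
    simpa [radPow] using h
  | succ k ih =>
    rw [radPow_succ, radPow_succ, Submodule.map_smul'']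
    exact smul_mono_right _ ih

theorem eq_top_of_sup_jacobson_smul_eq_top [Module.Finite A M] {U : Submodule A M}
    (h : U ⊔ Ring.jacobson A • ⊤ = ⊤) : U = ⊤ := by
  by_contra hU
  obtain ⟨C, hC, hle⟩ := (eq_top_or_exists_le_coatom U).resolve_left hU
  refine hC.1 (eq_top_iff.2 (h ▸ sup_le hle ?_))
  rw [← jacobson_eq_smul_top]
  exact sInf_le hC

theorem jacobson_smul_top_lt [Module.Finite A M] [Nontrivial M] :
    Ring.jacobson A • (⊤ : Submodule A M) < ⊤ :=
  Submodule.jacobson_smul_lt_top _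

variable (A M) in
/-- A module is sum-local if it is nonzero and not a sum of two proper submodules. -/
def IsSumLocal : Prop :=
  Nontrivial M ∧ ∀ X Y : Submodule A M, X ⊔ Y = ⊤ → X = ⊤ ∨ Y = ⊤

theorem IsSumLocal.le_jacobson_smul (h : IsSumLocal A M) {X : Submodule A M} (hX : X ≠ ⊤) :
    X ≤ Ring.jacobson A • ⊤ := by
  rw [← jacobson_eq_smul_top]
  refine le_sInf fun C hC ↦ ?_
  by_contra hle
  have : X ⊔ C = ⊤ := (hC.2 _ (right_lt_sup.2 hle))
  exact (h.2 X C this).elim hX hC.1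

theorem IsSumLocal.of_surjective (h : IsSumLocal A M) [Nontrivial N] (f : M →ₗ[A] N)
    (hf : Function.Surjective f) : IsSumLocal A N := by
  refine ⟨inferInstance, fun X Y hXY ↦ ?_⟩
  have key : X.comap f ⊔ Y.comap f = ⊤ := by
    refine eq_top_iff.2 fun m _ ↦ ?_
    obtain ⟨x, hx, y, hy, hxy⟩ := Submodule.mem_sup.1 (hXY ▸ trivial : f m ∈ X ⊔ Y)
    obtain ⟨x', rfl⟩ := hf x
    refine Submodule.mem_sup.2 ⟨x', hx, m - x', ?_, by abel⟩
    rw [Submodule.mem_comap, map_sub, ← hxy, add_sub_cancel_left]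
    exact hy
  refine (h.2 _ _ key).imp (fun h ↦ ?_) fun h ↦ ?_
  · rw [← Submodule.map_comap_eq_of_surjective hf X, h, Submodule.map_top,
      LinearMap.range_eq_top.2 hf]
  · rw [← Submodule.map_comap_eq_of_surjective hf Y, h, Submodule.map_top,
      LinearMap.range_eq_top.2 hf]

end Radical

section Uniserial

variable {A : Type*} [Ring A] [IsArtinianRing A] {M : Type*} [AddCommGroup M] [Module A M]
  [Module.Finite A M]

theorem moduleLength_eq : moduleLength A M = ((len A M : ℕ∞) : WithBot ℕ∞) := by
  rw [coe_len, Module.coe_length, moduleLength]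

theorem len_eq_of_moduleLength_eq {l : ℕ} (h : moduleLength A M = l) : len A M = l := by
  rw [moduleLength_eq] at h
  exact_mod_cast h

theorem isSumLocal_of_isUniserialModule_quotient [Nontrivial M] (U : Submodule A M)
    (hU : U ≤ Ring.jacobson A • ⊤) (h : IsUniserialModule A (M ⧸ U)) : IsSumLocal A M := by
  have key : ∀ X Y : Submodule A M, X ⊔ Y = ⊤ → X.map U.mkQ ≤ Y.map U.mkQ → Y = ⊤ := by
    intro X Y hXY hle
    apply eq_top_of_sup_jacobson_smul_eq_top
    rw [Submodule.map_le_iff_le_comap, Submodule.comap_map_mkQ] at hle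
    refine eq_top_iff.2 (hXY.symm.le.trans ?_)
    exact sup_le (hle.trans (sup_le (hU.trans le_sup_right) le_sup_left)) le_sup_left
  refine ⟨inferInstance, fun X Y hXY ↦ ?_⟩
  rcases h (X.map U.mkQ) (Y.map U.mkQ) with h | h
  · exact .inr (key X Y hXY h)
  · exact .inl (key Y X (sup_comm X Y ▸ hXY) h)

theorem IsFactorSerial.len_le_of_not_isSumLocal [Nontrivial M] {i : ℕ}
    (h : IsFactorSerial A M i) (hM : ¬ IsSumLocal A M) : len A M ≤ i := by
  rcases h with ⟨-, hu⟩ | ⟨-, -, l, hl, hil, hu, -⟩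
  · refine absurd ⟨inferInstance, fun X Y hXY ↦ ?_⟩ hM
    rcases hu X Y with h | h
    · exact .inr (by rwa [sup_eq_right.2 h] at hXY)
    · exact .inl (by rwa [sup_eq_left.2 h] at hXY)
  · rw [len_eq_of_moduleLength_eq hl]
    by_contra hlt
    refine hM (isSumLocal_of_isUniserialModule_quotient _ ?_ hu)
    rw [← radPow_one]
    exact radPow_antitone (by omega)

end Uniserial

section Quotient

variable {A : Type*} [Ring A] [IsArtinianRing A] {M : Type*} [AddCommGroup M] [Module A M]
  [Module.Finite A M]

theorem jacobson_smul_top_prod : Ring.jacobson A • (⊤ : Submodule A (M × M)) =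
    (Ring.jacobson A • (⊤ : Submodule A M)).prod (Ring.jacobson A • ⊤) := by
  apply le_antisymm
  · rw [Submodule.le_prod_iff, Submodule.map_smul'', Submodule.map_smul'']
    exact ⟨smul_mono_right _ le_top, smul_mono_right _ le_top⟩
  · rw [Submodule.prod_le_iff, Submodule.map_smul'', Submodule.map_smul'']
    exact ⟨smul_mono_right _ le_top, smul_mono_right _ le_top⟩

theorem len_comap_le_of_bijective {N N' : Type*} [AddCommGroup N] [Module A N]
    [AddCommGroup N'] [Module A N'] [Module.Finite A N] (f : M →ₗ[A] N) (hf : Function.Injective f)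
    (g : N →ₗ[A] N') (L : Submodule A N') : len A (L.comap (g ∘ₗ f)) ≤ len A (L.comap g) :=
  len_le_of_injective (f.restrict (p := L.comap (g ∘ₗ f)) (q := L.comap g) fun _ hx ↦ hx)
    fun _ _ hxy ↦ Subtype.ext (hf (congrArg Subtype.val hxy))

theorem IsSumLocal.bijective_or_range_le (hM : IsSumLocal A M) (f : M →ₗ[A] M) :
    Function.Bijective f ∨ LinearMap.range f ≤ Ring.jacobson A • ⊤ := by
  by_cases h : LinearMap.range f = ⊤
  · exact .inl (IsNoetherian.bijective_of_surjective_endomorphism f (LinearMap.range_eq_top.1 h))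
  · exact .inr (hM.le_jacobson_smul h)

variable (hM : IsSumLocal A M) (L : Submodule A (M × M))
include hM

theorem IsSumLocal.len_le_len_comap_add_of_isCompl
    (hlift : ∀ h : M →ₗ[A] (M × M) ⧸ L, ∃ k : M →ₗ[A] M × M, L.mkQ ∘ₗ k = h) {c : ℕ}
    (h₁ : ∀ g : M →ₗ[A] M, len A (L.comap (LinearMap.id.prod g)) ≤ c)
    (h₂ : ∀ g : M →ₗ[A] M, len A (L.comap (g.prod LinearMap.id)) ≤ c)
    {X Y : Submodule A ((M × M) ⧸ L)} (hXY : IsCompl X Y) (hX : X ≠ ⊥) (hY : Y ≠ ⊥) :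
    len A M ≤ len A X + c := by
  have hJ : ∀ X Y : Submodule A ((M × M) ⧸ L), IsCompl X Y → Y ≠ ⊥ →
      ¬ Y ≤ Ring.jacobson A • ⊤ := by
    intro X Y hXY hY hle
    have : X = ⊤ := eq_top_of_sup_jacobson_smul_eq_top
      (eq_top_iff.2 (hXY.sup_eq_top.symm.le.trans (sup_le_sup_left hle _)))
    exact hY (by simpa [this] using hXY.inf_eq_bot)
  have hmap : Submodule.map L.mkQ (Ring.jacobson A • ⊤) ≤ Ring.jacobson A • ⊤ := by
    rw [Submodule.map_smul'']
    exact smul_mono_right _ le_top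
  let p := X.projectionOnto Y hXY
  have hp (z) : p z = 0 ↔ z ∈ Y := Submodule.projectionOnto_apply_eq_zero_iff hXY
  obtain ⟨f, hf⟩ : ∃ f : M →ₗ[A] X, Function.Surjective f := by
    by_contra! hns
    have h1 : Y.comap L.mkQ ≤ (Ring.jacobson A • (⊤ : Submodule A M)).prod
        (Ring.jacobson A • ⊤) := by
      rw [Submodule.le_prod_iff]
      constructor
      · refine hM.le_jacobson_smul fun htop ↦ hns (p ∘ₗ L.mkQ ∘ₗ LinearMap.inr A M M) fun x ↦ ?_
        obtain ⟨z, hz⟩ := Submodule.projectionOnto_surjective hXY x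
        obtain ⟨⟨a, b⟩, rfl⟩ := L.mkQ_surjective z
        obtain ⟨⟨a', b'⟩, hab, rfl⟩ := (htop ▸ trivial : a ∈ (Y.comap L.mkQ).map (LinearMap.fst A M M))
        refine ⟨b - b', ?_⟩
        have : p (L.mkQ (a', b')) = 0 := (hp _).2 hab
        rw [← hz, ← sub_zero (Submodule.projectionOnto X Y hXY _), ← this]
        change p _ = p _ - p _
        rw [← map_sub, ← map_sub]
        simp
      · refine hM.le_jacobson_smul fun htop ↦ hns (p ∘ₗ L.mkQ ∘ₗ LinearMap.inl A M M) fun x ↦ ?_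
        obtain ⟨z, hz⟩ := Submodule.projectionOnto_surjective hXY x
        obtain ⟨⟨a, b⟩, rfl⟩ := L.mkQ_surjective z
        obtain ⟨⟨a', b'⟩, hab, rfl⟩ := (htop ▸ trivial : b ∈ (Y.comap L.mkQ).map (LinearMap.snd A M M))
        refine ⟨a - a', ?_⟩
        have : p (L.mkQ (a', b')) = 0 := (hp _).2 hab
        rw [← hz, ← sub_zero (Submodule.projectionOnto X Y hXY _), ← this]
        change p _ = p _ - p _
        rw [← map_sub, ← map_sub]
        simp
    rw [← jacobson_smul_top_prod] at h1
    refine hJ X Y hXY hY ?_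
    rw [← Submodule.map_comap_eq_of_surjective L.mkQ_surjective Y]
    exact (Submodule.map_mono h1).trans hmap
  obtain ⟨k, hk⟩ := hlift (X.subtype ∘ₗ f)
  have hker : LinearMap.ker f = L.comap k := by
    rw [← LinearMap.ker_comp_of_ker_eq_bot f X.ker_subtype, ← hk, LinearMap.ker_comp,
      Submodule.ker_mkQ]
  have hlen := len_ker_add_range f
  rw [LinearMap.range_eq_top.2 hf, len_top, hker] at hlen
  suffices len A (L.comap k) ≤ c by omega
  rcases hM.bijective_or_range_le (LinearMap.fst A M M ∘ₗ k) with hb | hr₁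
  · let e := LinearEquiv.ofBijective _ hb
    have he (x) : e.symm (k x).1 = x := e.symm_apply_apply x
    have : k = (LinearMap.id.prod (LinearMap.snd A M M ∘ₗ k ∘ₗ e.symm.toLinearMap)) ∘ₗ
        e.toLinearMap := by
      ext x <;> simp [he, show e x = (k x).1 from rfl]
    rw [this]
    exact (len_comap_le_of_bijective _ e.injective _ _).trans (h₁ _)
  rcases hM.bijective_or_range_le (LinearMap.snd A M M ∘ₗ k) with hb | hr₂
  · let e := LinearEquiv.ofBijective _ hb
    have he (x) : e.symm (k x).2 = x := e.symm_apply_apply x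
    have : k = ((LinearMap.fst A M M ∘ₗ k ∘ₗ e.symm.toLinearMap).prod LinearMap.id) ∘ₗ
        e.toLinearMap := by
      ext x <;> simp [he, show e x = (k x).2 from rfl]
    rw [this]
    exact (len_comap_le_of_bijective _ e.injective _ _).trans (h₂ _)
  · refine absurd ?_ (hJ Y X hXY.symm hX)
    have hr : LinearMap.range k ≤ Ring.jacobson A • ⊤ := by
      rw [jacobson_smul_top_prod, Submodule.le_prod_iff, ← LinearMap.range_comp,
        ← LinearMap.range_comp]
      exact ⟨hr₁, hr₂⟩
    have : X = (LinearMap.range k).map L.mkQ := by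
      rw [← LinearMap.range_comp, hk, LinearMap.range_comp, LinearMap.range_eq_top.2 hf]
      simp
    rw [this]
    exact (Submodule.map_mono hr).trans hmap

theorem IsSumLocal.isIndecModule_quotient
    (hL : L ≤ (Ring.jacobson A • (⊤ : Submodule A M)).prod (Ring.jacobson A • ⊤))
    (hlift : ∀ h : M →ₗ[A] (M × M) ⧸ L, ∃ k : M →ₗ[A] M × M, L.mkQ ∘ₗ k = h) {c : ℕ}
    (h₁ : ∀ g : M →ₗ[A] M, len A (L.comap (LinearMap.id.prod g)) ≤ c)
    (h₂ : ∀ g : M →ₗ[A] M, len A (L.comap (g.prod LinearMap.id)) ≤ c) (hc : 2 * c < len A L) :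
    IsIndecModule A ((M × M) ⧸ L) ∧ ¬ IsSumLocal A ((M × M) ⧸ L) := by
  have := hM.1
  rw [← jacobson_smul_top_prod] at hL
  have hne : Nontrivial ((M × M) ⧸ L) :=
    Submodule.Quotient.nontrivial_iff.2 (hL.trans_lt jacobson_smul_top_lt).ne
  refine ⟨⟨hne, fun X Y hXY ↦ ?_⟩, fun hloc ↦ ?_⟩
  · by_contra! hXY0
    have hX := hM.len_le_len_comap_add_of_isCompl L hlift h₁ h₂ hXY hXY0.1 hXY0.2
    have hY := hM.len_le_len_comap_add_of_isCompl L hlift h₁ h₂ hXY.symm hXY0.2 hXY0.1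
    have h := len_congr (Submodule.prodEquivOfIsCompl X Y hXY)
    have h' := len_submodule_add_quotient L
    rw [len_prod] at h h'
    omega
  · have hJ : Ring.jacobson A • (⊤ : Submodule A M) ≠ ⊤ := (jacobson_smul_top_lt (A := A)).ne
    rw [jacobson_smul_top_prod] at hL
    have key : ∀ V : Submodule A (M × M), L ≤ V → V.map L.mkQ = ⊤ → V = ⊤ := by
      intro V hV h
      rw [← sup_eq_right.2 hV, ← Submodule.comap_map_mkQ, h, Submodule.comap_top]
    have hsup : (⊤ : Submodule A M).prod (Ring.jacobson A • (⊤ : Submodule A M)) ⊔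
        (Ring.jacobson A • (⊤ : Submodule A M)).prod (⊤ : Submodule A M) = ⊤ := by
      rw [Submodule.prod_sup_prod]
      simp
    have hsup' := congrArg (Submodule.map L.mkQ) hsup
    rw [Submodule.map_sup, Submodule.map_top, Submodule.range_mkQ] at hsup'
    rcases hloc.2 _ _ hsup' with h | h
    · refine hJ (eq_top_iff.2 fun x _ ↦ ?_)
      have := key _ (hL.trans (Submodule.prod_mono le_top le_rfl)) h
      exact (this.ge (Submodule.mem_top (x := (x, x)))).2
    · refine hJ (eq_top_iff.2 fun x _ ↦ ?_)
      have := key _ (hL.trans (Submodule.prod_mono le_rfl le_top)) h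
      exact (this.ge (Submodule.mem_top (x := (x, x)))).1

end Quotient

section Pairs

variable {A : Type*} [Ring A] [IsArtinianRing A] {M : Type*} [AddCommGroup M] [Module A M]
  [Module.Finite A M] {S : Type*} [AddCommGroup S] [Module A S] [IsSimpleModule A S]

theorem eq_zero_of_apply_mem {B : Submodule A M} {u : S →ₗ[A] M} (hu : ¬ LinearMap.range u ≤ B)
    {s : S} (hs : u s ∈ B) : s = 0 := by
  have : B.comap u = ⊥ := (eq_bot_or_eq_top _).resolve_right fun h ↦ hu (by
    rintro _ ⟨s, rfl⟩
    exact h.ge (Submodule.mem_top (x := s)))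
  exact this.le hs

theorem len_le_of_forall_mem_iff {B₁ B₂ K : Submodule A M} {u w : S →ₗ[A] M} {g : M →ₗ[A] M}
    (hu : ¬ LinearMap.range u ≤ B₁)
    (hg : ¬ (B₁ ≤ B₂.comap g ∧ ∀ s, g (u s) - w s ∈ B₂))
    (hK : ∀ x, x ∈ K ↔ ∃ s, x - u s ∈ B₁ ∧ g x - w s ∈ B₂) : len A K ≤ len A B₁ := by
  have hinj : Function.Injective (B₁.subtype.coprod u) := by
    rw [← LinearMap.ker_eq_bot, LinearMap.ker_eq_bot']
    rintro ⟨a, s⟩ h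
    have h' : (a : M) + u s = 0 := by simpa using h
    have hs : s = 0 := eq_zero_of_apply_mem hu (by
      rw [eq_neg_of_add_eq_zero_right h']
      exact neg_mem a.2)
    subst hs
    simpa using h'
  have hlen := len_range_of_injective _ hinj
  rw [len_prod, len_eq_one_iff.2 ‹IsSimpleModule A S›] at hlen
  have hle : K ≤ LinearMap.range (B₁.subtype.coprod u) := by
    intro x hx
    obtain ⟨s, hs, -⟩ := (hK x).1 hx
    exact ⟨(⟨_, hs⟩, s), by simp⟩
  have hlt : K < LinearMap.range (B₁.subtype.coprod u) := by
    refine lt_of_le_of_ne hle fun heq ↦ hg ⟨fun a ha ↦ ?_, fun s ↦ ?_⟩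
    · have hK' : a ∈ K := heq.ge ⟨(⟨a, ha⟩, 0), by simp⟩
      obtain ⟨s, hs, hs'⟩ := (hK a).1 hK'
      have : s = 0 := eq_zero_of_apply_mem hu (by simpa using B₁.sub_mem ha hs)
      simpa [this] using hs'
    · have hK' : u s ∈ K := heq.ge ⟨(0, s), by simp⟩
      obtain ⟨t, ht, ht'⟩ := (hK _).1 hK'
      have : s - t = 0 := eq_zero_of_apply_mem hu (by simpa using ht)
      rwa [← sub_eq_zero.1 this] at ht'
  have := len_lt_of_lt hlt
  omega

theorem exists_linearMap_of_isSumLocal (hM : IsSumLocal A M)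
    (hlift : ∀ L : Submodule A (M × M), ∀ h : M →ₗ[A] (M × M) ⧸ L,
      ∃ k : M →ₗ[A] M × M, L.mkQ ∘ₗ k = h)
    (hloc : ∀ L : Submodule A (M × M), IsIndecModule A ((M × M) ⧸ L) →
      ¬ IsSumLocal A ((M × M) ⧸ L) → len A ((M × M) ⧸ L) ≤ 4) (hlen : 4 ≤ len A M)
    {B₁ B₂ : Submodule A M} (hB₁ : B₁ ≤ Ring.jacobson A • ⊤) (hB₂ : B₂ ≤ Ring.jacobson A • ⊤)
    (hB : len A B₁ ≤ 1) (hBB : len A B₁ = len A B₂) (u w : S →ₗ[A] M)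
    (huJ : LinearMap.range u ≤ Ring.jacobson A • ⊤) (hwJ : LinearMap.range w ≤ Ring.jacobson A • ⊤)
    (hu : ¬ LinearMap.range u ≤ B₁) (hw : ¬ LinearMap.range w ≤ B₂) :
    ∃ g : M →ₗ[A] M, (B₁ ≤ B₂.comap g ∧ ∀ s, g (u s) - w s ∈ B₂) ∨
      (B₂ ≤ B₁.comap g ∧ ∀ s, g (w s) - u s ∈ B₁) := by
  by_contra! hg
  let f := (B₁.subtype.prodMap B₂.subtype).coprod (u.prod w)
  have hf : Function.Injective f := by
    rw [← LinearMap.ker_eq_bot, LinearMap.ker_eq_bot']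
    rintro ⟨⟨a, b⟩, s⟩ h
    have h' : (a : M) + u s = 0 ∧ (b : M) + w s = 0 := by simpa [f] using h
    have hs : s = 0 := eq_zero_of_apply_mem hu (by
      rw [eq_neg_of_add_eq_zero_right h'.1]
      exact neg_mem a.2)
    subst hs
    simpa using h'
  have hmem (x y : M) : (x, y) ∈ LinearMap.range f ↔ ∃ s, x - u s ∈ B₁ ∧ y - w s ∈ B₂ := by
    constructor
    · rintro ⟨⟨⟨a, b⟩, s⟩, h⟩
      have h' : (a : M) + u s = x ∧ (b : M) + w s = y := by simpa [f] using h
      refine ⟨s, ?_⟩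
      simp [← h'.1, ← h'.2]
    · rintro ⟨s, hx, hy⟩
      exact ⟨((⟨_, hx⟩, ⟨_, hy⟩), s), by simp [f]⟩
  have hlenL := len_range_of_injective f hf
  rw [len_prod, len_prod, len_eq_one_iff.2 ‹IsSimpleModule A S›] at hlenL
  have hL : LinearMap.range f ≤ (Ring.jacobson A • (⊤ : Submodule A M)).prod
      (Ring.jacobson A • (⊤ : Submodule A M)) := by
    rintro ⟨x, y⟩ hxy
    obtain ⟨s, hx, hy⟩ := (hmem x y).1 hxy
    constructor
    · simpa using add_mem (hB₁ hx) (huJ ⟨s, rfl⟩)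
    · simpa using add_mem (hB₂ hy) (hwJ ⟨s, rfl⟩)
  obtain ⟨hi, hl⟩ := hM.isIndecModule_quotient (LinearMap.range f) hL (hlift _) (c := len A B₁)
    (fun g ↦ len_le_of_forall_mem_iff hu (fun h ↦ (hg g).1 h.1 |>.elim fun s hs ↦ hs (h.2 s))
      fun x ↦ hmem x (g x))
    (fun g ↦ hBB ▸ len_le_of_forall_mem_iff hw
      (fun h ↦ (hg g).2 h.1 |>.elim fun s hs ↦ hs (h.2 s))
      fun x ↦ (hmem (g x) x).trans (exists_congr fun _ ↦ and_comm)) (by omega)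
  have h₁ := hloc _ hi hl
  have h₂ := len_submodule_add_quotient (LinearMap.range f)
  rw [len_prod] at h₂
  omega

end Pairs

section Endomorphisms

variable {R : Type*} [CommRing R] [IsArtinianRing R] {A : Type*} [Ring A] [IsArtinianRing A]
  [Algebra R A] [Module.Finite R A] {M : Type*} [AddCommGroup M] [Module A M] [Module.Finite A M]
  [Module R M] [IsScalarTower R A M] {S : Type*} [AddCommGroup S] [Module A S] [Module R S]
  [IsScalarTower R A S] [IsSimpleModule A S]

variable (R A M S) in
theorem finite_linearMap_of_isSimpleModule : Module.Finite R (S →ₗ[A] M) := by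
  have : Nontrivial S := IsSimpleModule.nontrivial A S
  obtain ⟨s, hs⟩ := exists_ne (0 : S)
  have : Module.Finite R M := Module.Finite.trans A M
  let ev : (S →ₗ[A] M) →ₗ[R] M :=
    { toFun := fun f ↦ f s
      map_add' := fun _ _ ↦ rfl
      map_smul' := fun _ _ ↦ rfl }
  refine Module.Finite.of_injective ev ((injective_iff_map_eq_zero ev).2 fun f hf ↦ ?_)
  rcases f.injective_or_eq_zero with h | h
  · exact absurd (h (hf.trans (map_zero f).symm)) hs
  · exact h

theorem exists_forall_exists_notMem (u v : S →ₗ[A] M) (B : Submodule A M)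
    (huv : ∀ α β : S →ₗ[A] S, (∀ s, u (α s) + v (β s) ∈ B) → α = 0 ∧ β = 0)
    (E : Submodule R (M →ₗ[A] M)) (χ : E →ₗ[R] S →ₗ[A] S)
    (hχ : ∀ g : E, χ g = 0 → ∀ s, (g : M →ₗ[A] M) (u s) ∈ B) :
    ∃ α β : S →ₗ[A] S, ∀ g ∈ E, ∃ s, g (u s) - (u (α s) + v (β s)) ∉ B := by
  by_contra! hall
  have := finite_linearMap_of_isSimpleModule R A S S
  have := finite_linearMap_of_isSimpleModule R A (M ⧸ B) S
  have : Nontrivial S := IsSimpleModule.nontrivial A S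
  let φ : E →ₗ[R] S →ₗ[A] M ⧸ B :=
    { toFun := fun g ↦ B.mkQ ∘ₗ g.1 ∘ₗ u
      map_add' := fun _ _ ↦ by ext; simp
      map_smul' := fun _ _ ↦ by ext; simp }
  let ψ : ((S →ₗ[A] S) × (S →ₗ[A] S)) →ₗ[R] S →ₗ[A] M ⧸ B :=
    { toFun := fun p ↦ B.mkQ ∘ₗ (u ∘ₗ p.1 + v ∘ₗ p.2)
      map_add' := fun _ _ ↦ by ext; simp; abel
      map_smul' := fun r p ↦ by
        ext s
        simp [LinearMap.map_smul_of_tower] }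
  have hψ : Function.Injective ψ := by
    rw [← LinearMap.ker_eq_bot, LinearMap.ker_eq_bot']
    rintro ⟨α, β⟩ h
    obtain ⟨rfl, rfl⟩ := huv α β fun s ↦ by
      simpa [ψ, ← Submodule.Quotient.mk_add] using LinearMap.congr_fun h s
    rfl
  have hle : LinearMap.range ψ ≤ LinearMap.range φ := by
    rintro _ ⟨⟨α, β⟩, rfl⟩
    obtain ⟨g, hg, h⟩ := hall α β
    refine ⟨⟨g, hg⟩, LinearMap.ext fun s ↦ ?_⟩
    exact (Submodule.Quotient.eq B).2 (h s)
  have hker : LinearMap.ker χ ≤ LinearMap.ker φ := fun g hg ↦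
    LinearMap.ext fun s ↦ (Submodule.Quotient.mk_eq_zero B).2 (hχ g hg s)
  have : Module.Finite R (E ⧸ LinearMap.ker χ) := Module.Finite.equiv χ.quotKerEquivRange.symm
  have h₁ : len R (LinearMap.range φ) ≤ len R (E ⧸ LinearMap.ker χ) := by
    rw [← Submodule.range_liftQ _ _ hker]
    exact len_le_of_surjective _ (LinearMap.surjective_rangeRestrict _)
  have h₂ : len R (E ⧸ LinearMap.ker χ) ≤ len R (S →ₗ[A] S) :=
    len_le_of_injective ((LinearMap.range χ).subtype ∘ₗ χ.quotKerEquivRange.toLinearMap)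
      ((Submodule.injective_subtype _).comp χ.quotKerEquivRange.injective)
  have h₃ := len_range_of_injective ψ hψ
  have h₄ := len_mono hle
  have h₅ : 0 < len R (S →ₗ[A] S) := len_pos
  rw [len_prod] at h₃
  omega

theorem mem_of_apply_mem {B : Submodule A M} {g : M →ₗ[A] M} (hg : Function.Injective g)
    (hB : B ≤ B.comap g) {x : M} (hx : g x ∈ B) : x ∈ B := by
  obtain ⟨b, hb⟩ := (IsArtinian.bijective_of_injective_endomorphism (g.restrict hB)
    fun x y h ↦ Subtype.ext (hg (congrArg Subtype.val h))).2 ⟨_, hx⟩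
  rw [← hg (congrArg Subtype.val hb)]
  exact b.2

variable (R) in
/-- The endomorphisms that preserve a given submodule. -/
def preserving (B : Submodule A M) : Submodule R (M →ₗ[A] M) where
  carrier := {g | B ≤ B.comap g}
  add_mem' hf hg _ hx := B.add_mem (hf hx) (hg hx)
  zero_mem' _ _ := B.zero_mem
  smul_mem' r _ hg _ hx := B.smul_of_tower_mem r (hg hx)

theorem false_of_endomorphisms (hM : IsSumLocal A M)
    (hlift : ∀ L : Submodule A (M × M), ∀ h : M →ₗ[A] (M × M) ⧸ L,
      ∃ k : M →ₗ[A] M × M, L.mkQ ∘ₗ k = h)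
    (hloc : ∀ L : Submodule A (M × M), IsIndecModule A ((M × M) ⧸ L) →
      ¬ IsSumLocal A ((M × M) ⧸ L) → len A ((M × M) ⧸ L) ≤ 4) (hlen : 4 ≤ len A M)
    {B : Submodule A M} (hBJ : B ≤ Ring.jacobson A • ⊤) (hB : len A B ≤ 1) (u v : S →ₗ[A] M)
    (huJ : LinearMap.range u ≤ Ring.jacobson A • ⊤) (hvJ : LinearMap.range v ≤ Ring.jacobson A • ⊤)
    (huv : ∀ α β : S →ₗ[A] S, (∀ s, u (α s) + v (β s) ∈ B) → α = 0 ∧ β = 0)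
    (hkill : ∀ g : M →ₗ[A] M, Function.Bijective g ∨ ∀ s, g (u s) = 0 ∧ g (v s) = 0)
    (χ : preserving R B →ₗ[R] S →ₗ[A] S)
    (hχ : ∀ g, χ g = 0 → ∀ s, (g : M →ₗ[A] M) (u s) ∈ B) : False := by
  have : Nontrivial S := IsSimpleModule.nontrivial A S
  obtain ⟨α, β, h⟩ := exists_forall_exists_notMem u v B huv _ χ hχ
  have hu : ¬ LinearMap.range u ≤ B := fun hle ↦
    one_ne_zero (huv 1 0 fun s ↦ by simpa using hle ⟨s, rfl⟩).1
  have hw : ¬ LinearMap.range (u ∘ₗ α + v ∘ₗ β) ≤ B := fun hle ↦ by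
    obtain ⟨s, hs⟩ := h 0 (Submodule.zero_mem _)
    exact hs (by simpa using B.neg_mem (hle ⟨s, rfl⟩))
  have hwJ : LinearMap.range (u ∘ₗ α + v ∘ₗ β) ≤ Ring.jacobson A • ⊤ := by
    rintro _ ⟨s, rfl⟩
    exact add_mem (huJ ⟨_, rfl⟩) (hvJ ⟨_, rfl⟩)
  obtain ⟨g, ⟨hg, hgu⟩ | ⟨hg, hgw⟩⟩ := exists_linearMap_of_isSumLocal hM hlift hloc hlen hBJ hBJ hB
    rfl u (u ∘ₗ α + v ∘ₗ β) huJ hwJ hu hw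
  · obtain ⟨s, hs⟩ := h g hg
    exact hs (hgu s)
  · rcases hkill g with hb | hz
    · let e := LinearEquiv.ofBijective g hb
      have he (x) : g (e.symm x) = x := e.apply_symm_apply x
      obtain ⟨s, hs⟩ := h e.symm.toLinearMap fun x hx ↦
        mem_of_apply_mem hb.1 hg (by simpa [he] using hx)
      refine hs (mem_of_apply_mem hb.1 hg ?_)
      rw [map_sub]
      simpa [he] using B.neg_mem (hgw s)
    · refine hu ?_
      rintro _ ⟨s, rfl⟩
      simpa [(hz _).1, (hz _).2] using B.neg_mem (hgw s)

end Endomorphisms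

section Core

theorem exists_isSimpleModule_disjoint {A : Type*} [Ring A] [IsArtinianRing A] {M : Type*}
    [AddCommGroup M] [Module A M] {T Q : Submodule A M} (hT : Ring.jacobson A • T = ⊥)
    (hQ : ¬ T ≤ Q) : ∃ W ≤ T, IsSimpleModule A W ∧ Disjoint W Q := by
  have := isSemisimpleModule_submodule T hT
  obtain ⟨W, hW, hWQ⟩ : ∃ W : Submodule A T, IsSimpleModule A W ∧ ¬ W ≤ Q.comap T.subtype := by
    by_contra! h
    refine hQ fun x hx ↦ ?_
    have : (⊤ : Submodule A T) ≤ Q.comap T.subtype := by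
      rw [← IsSemisimpleModule.sSup_simples_eq_top]
      exact sSup_le fun W hW ↦ h W hW
    exact this (x := ⟨x, hx⟩) trivial
  have e := Submodule.equivMapOfInjective T.subtype T.injective_subtype W
  have hs : IsSimpleModule A (W.map T.subtype) := IsSimpleModule.congr e.symm
  refine ⟨W.map T.subtype, Submodule.map_subtype_le T W, hs, ?_⟩
  rw [(isSimpleModule_iff_isAtom.1 hs : IsAtom _).not_le_iff_disjoint.symm,
    Submodule.map_le_iff_le_comap]
  exact hWQ

theorem len_sup_le {A : Type*} [Ring A] [IsArtinianRing A] {M : Type*} [AddCommGroup M]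
    [Module A M] [Module.Finite A M] (U V : Submodule A M) :
    len A ↥(U ⊔ V) ≤ len A U + len A V := by
  rw [← len_prod, Submodule.sup_eq_range]
  exact len_le_of_surjective _ (LinearMap.surjective_rangeRestrict _)

variable {R : Type*} [CommRing R] [IsArtinianRing R] {A : Type*} [Ring A] [IsArtinianRing A]
  [Algebra R A] [Module.Finite R A] {M : Type*} [AddCommGroup M] [Module A M] [Module.Finite A M]
  [Module R M] [IsScalarTower R A M]

variable (hM : IsSumLocal A M)
  (hlift : ∀ L : Submodule A (M × M), ∀ h : M →ₗ[A] (M × M) ⧸ L,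
    ∃ k : M →ₗ[A] M × M, L.mkQ ∘ₗ k = h)
  (hloc : ∀ L : Submodule A (M × M), IsIndecModule A ((M × M) ⧸ L) →
    ¬ IsSumLocal A ((M × M) ⧸ L) → len A ((M × M) ⧸ L) ≤ 4) (hlen : 4 ≤ len A M)
  {X T : Submodule A M} (hXT : X ≤ T) (hTJ : T ≤ Ring.jacobson A • ⊤)
  (hT : Ring.jacobson A • T = ⊥)
  (hkill : ∀ g : M →ₗ[A] M, Function.Bijective g ∨ X ≤ LinearMap.ker g)
include hM hlift hloc hlen hkill

theorem nonempty_linearEquiv_of_disjoint (hXJ : X ≤ Ring.jacobson A • ⊤)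
    {U V W : Submodule A M} (hU : U ≤ X) (hV : V ≤ X)
    (hW : W ≤ Ring.jacobson A • ⊤) (hUs : IsSimpleModule A U) (hVs : IsSimpleModule A V)
    (hWs : IsSimpleModule A W) (hUV : Disjoint U V) (hVW : Disjoint V W) :
    Nonempty (U ≃ₗ[A] W) := by
  have key : ∀ {C : Submodule A M}, Disjoint V C → ¬ LinearMap.range V.subtype ≤ C := by
    intro C h hle
    rw [Submodule.range_subtype] at hle
    exact (isSimpleModule_iff_isAtom.1 hVs).1 (h le_rfl hle |> fun h ↦ le_bot_iff.1 h)
  have hzero : ∀ {B C : Submodule A M} (_ : IsSimpleModule A B) (_ : IsSimpleModule A C)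
      (g : M →ₗ[A] M), B ≤ C.comap g → IsEmpty (B ≃ₗ[A] C) → X ≤ LinearMap.ker g := by
    intro B C _ _ g hg hBC
    refine (hkill g).resolve_left fun hb ↦ ?_
    rcases (g.restrict hg).bijective_or_eq_zero with h | h
    · exact hBC.false (LinearEquiv.ofBijective _ h)
    · have : Nontrivial B := IsSimpleModule.nontrivial A B
      obtain ⟨b, hb'⟩ := exists_ne (0 : B)
      have : g b = 0 := congrArg Subtype.val (LinearMap.congr_fun h b)
      exact hb' (Subtype.ext (hb.1 (this.trans (map_zero g).symm)))
  by_contra hne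
  rw [not_nonempty_iff] at hne
  have hne' : IsEmpty (W ≃ₗ[A] U) := ⟨fun e ↦ hne.false e.symm⟩
  have hl : len A U = 1 := len_eq_one_iff.2 hUs
  obtain ⟨g, ⟨hg, h⟩ | ⟨hg, h⟩⟩ := exists_linearMap_of_isSumLocal hM hlift hloc hlen
    (hU.trans hXJ) hW hl.le (hl.trans (len_eq_one_iff.2 hWs).symm) V.subtype V.subtype
    (by simpa using hV.trans hXJ) (by simpa using hV.trans hXJ) (key hUV.symm) (key hVW)
  · refine key hVW ?_
    rintro _ ⟨s, rfl⟩
    have hs : g s = 0 := hzero hUs hWs g hg hne (hV s.2)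
    simpa [hs] using W.neg_mem (h s)
  · refine key hUV.symm ?_
    rintro _ ⟨s, rfl⟩
    have hs : g s = 0 := hzero hWs hUs g hg hne' (hV s.2)
    simpa [hs] using U.neg_mem (h s)

theorem false_of_disjoint (hXJ : X ≤ Ring.jacobson A • ⊤) {S : Type*} [AddCommGroup S] [Module A S]
    [Module R S] [IsScalarTower R A S] [IsSimpleModule A S] {U V B : Submodule A M}
    (hU : U ≤ X) (hV : V ≤ X) (hBJ : B ≤ Ring.jacobson A • ⊤) (hB : len A B ≤ 1)
    (hUV : Disjoint U V) (hBUV : Disjoint B (U ⊔ V)) (e : S ≃ₗ[A] U) (f : S ≃ₗ[A] V)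
    (χ : preserving R B →ₗ[R] S →ₗ[A] S)
    (hχ : ∀ g, χ g = 0 → X ≤ LinearMap.ker (g : M →ₗ[A] M)) : False := by
  refine false_of_endomorphisms hM hlift hloc hlen hBJ hB (U.subtype ∘ₗ e.toLinearMap)
    (V.subtype ∘ₗ f.toLinearMap) ?_ ?_ (fun α β h ↦ ?_) (fun g ↦ ?_) χ fun g hg s ↦ ?_
  · rintro _ ⟨s, rfl⟩
    exact hXJ (hU (e s).2)
  · rintro _ ⟨s, rfl⟩
    exact hXJ (hV (f s).2)
  · have key (s : S) : e (α s) = 0 ∧ f (β s) = 0 := by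
      have h₀ : (e (α s) : M) + f (β s) = 0 := Submodule.disjoint_def.1 hBUV _ (h s)
        (Submodule.add_mem_sup (e _).2 (f _).2)
      have h₁ : (e (α s) : M) = 0 := Submodule.disjoint_def.1 hUV _ (e _).2 (by
        rw [eq_neg_of_add_eq_zero_left h₀]
        exact V.neg_mem (f _).2)
      rw [h₁, zero_add] at h₀
      exact ⟨Subtype.ext h₁, Subtype.ext h₀⟩
    exact ⟨LinearMap.ext fun s ↦ by simpa using (key s).1,
      LinearMap.ext fun s ↦ by simpa using (key s).2⟩
  · exact (hkill g).imp_right fun h s ↦ ⟨h (hU (e s).2), h (hV (f s).2)⟩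
  · have : (g : M →ₗ[A] M) (e s) = 0 := hχ g hg (hU (e s).2)
    simp [this]

variable (R)
include R

theorem false_of_three_le_len (hXJ : X ≤ Ring.jacobson A • ⊤) (hJX : Ring.jacobson A • X = ⊥)
    (hX : 3 ≤ len A X) : False := by
  have hle {Q : Submodule A M} (hQ : len A Q ≤ 2) : ¬ X ≤ Q := fun h ↦ by
    have := len_mono h
    omega
  have h0 : len A (⊥ : Submodule A M) = 0 := by simp [len]
  obtain ⟨U, hU, hUs, -⟩ := exists_isSimpleModule_disjoint hJX (hle (h0.trans_le zero_le_two))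
  have hUl := len_eq_one_iff.2 hUs
  obtain ⟨V, hV, hVs, hVU⟩ := exists_isSimpleModule_disjoint hJX (hle (hUl.trans_le one_le_two))
  have hVl := len_eq_one_iff.2 hVs
  obtain ⟨W, hW, hWs, hWUV⟩ := exists_isSimpleModule_disjoint hJX (hle (Q := U ⊔ V) (by
    have := len_sup_le U V
    omega))
  obtain ⟨e⟩ := nonempty_linearEquiv_of_disjoint hM hlift hloc hlen hkill hXJ hU hV
    (hW.trans hXJ) hUs hVs hWs hVU.symm (hWUV.mono_right le_sup_right).symm
  obtain ⟨f⟩ := nonempty_linearEquiv_of_disjoint hM hlift hloc hlen hkill hXJ hV hU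
    (hW.trans hXJ) hVs hUs hWs hVU (hWUV.mono_right le_sup_left).symm
  let χ : preserving R W →ₗ[R] W →ₗ[A] W :=
    { toFun := fun g ↦ g.1.restrict g.2
      map_add' := fun _ _ ↦ rfl
      map_smul' := fun _ _ ↦ rfl }
  refine false_of_disjoint hM hlift hloc hlen hkill hXJ hU hV (hW.trans hXJ)
    (len_eq_one_iff.2 hWs).le hVU.symm hWUV e.symm f.symm χ fun g hg ↦ (hkill g).resolve_left ?_
  intro hb
  have : Nontrivial W := IsSimpleModule.nontrivial A W
  obtain ⟨w, hw⟩ := exists_ne (0 : W)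
  have : (g : M →ₗ[A] M) w = 0 := congrArg Subtype.val (LinearMap.congr_fun hg w)
  exact hw (Subtype.ext (hb.1 (this.trans (map_zero _).symm)))

theorem false_of_len_eq_add_one (hXT : X ≤ T) (hTJ : T ≤ Ring.jacobson A • ⊤)
    (hT : Ring.jacobson A • T = ⊥) (hX : 2 ≤ len A X) (hTX : len A T = len A X + 1)
    (hXinv : ∀ g : M →ₗ[A] M, X ≤ X.comap g) (hTinv : ∀ g : M →ₗ[A] M, T ≤ T.comap g) : False := by
  have hJX : Ring.jacobson A • X = ⊥ := le_bot_iff.1 ((smul_mono_right _ hXT).trans hT.le)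
  have hXJ := hXT.trans hTJ
  have hle {Q : Submodule A M} (hQ : len A Q ≤ 1) : ¬ X ≤ Q := fun h ↦ by
    have := len_mono h
    omega
  have h0 : len A (⊥ : Submodule A M) = 0 := by simp [len]
  obtain ⟨U, hU, hUs, -⟩ := exists_isSimpleModule_disjoint hJX (hle (h0.trans_le zero_le_one))
  obtain ⟨V, hV, hVs, hVU⟩ := exists_isSimpleModule_disjoint hJX (hle (len_eq_one_iff.2 hUs).le)
  obtain ⟨W, hW, hWs, hWX⟩ := exists_isSimpleModule_disjoint hT (Q := X) (fun h ↦ by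
    have := len_mono h
    omega)
  obtain ⟨e⟩ := nonempty_linearEquiv_of_disjoint hM hlift hloc hlen hkill hXJ hU hV
    (hW.trans hTJ) hUs hVs hWs hVU.symm (hWX.mono_right hV).symm
  obtain ⟨f⟩ := nonempty_linearEquiv_of_disjoint hM hlift hloc hlen hkill hXJ hV hU
    (hW.trans hTJ) hVs hUs hWs hVU (hWX.mono_right hU).symm
  have hsup : X ⊔ W = T := by
    refine eq_of_le_of_not_lt (sup_le hXT hW) fun hlt ↦ ?_
    have h₁ := len_lt_of_lt hlt
    have h₂ : X < X ⊔ W := left_lt_sup.2 fun h ↦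
      (isSimpleModule_iff_isAtom.1 hWs).1 (le_bot_iff.1 (hWX le_rfl h))
    have h₃ := len_lt_of_lt h₂
    omega
  let p : W →ₗ[A] T.map X.mkQ := X.mkQ.restrict fun x hx ↦ Submodule.mem_map_of_mem (hW hx)
  have hp : Function.Bijective p := by
    constructor
    · rw [← LinearMap.ker_eq_bot, LinearMap.ker_eq_bot']
      intro w hw
      refine Subtype.ext (Submodule.disjoint_def.1 hWX _ w.2 ?_)
      exact (Submodule.Quotient.mk_eq_zero X).1 (congrArg Subtype.val hw)
    · rintro ⟨_, t, ht, rfl⟩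
      rw [← hsup] at ht
      obtain ⟨x, hx, w, hw, rfl⟩ := Submodule.mem_sup.1 ht
      refine ⟨⟨w, hw⟩, Subtype.ext ?_⟩
      exact (Submodule.Quotient.eq X).2 (by simpa using X.neg_mem hx)
  let q := LinearEquiv.ofBijective p hp
  have : IsSimpleModule A (T.map X.mkQ) := IsSimpleModule.congr q.symm
  let χ : preserving R (⊥ : Submodule A M) →ₗ[R] T.map X.mkQ →ₗ[A] T.map X.mkQ :=
    { toFun := fun g ↦ (X.mkQ ∘ₗ g.1 ∘ₗ W.subtype ∘ₗ q.symm.toLinearMap).codRestrict _ fun s ↦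
        Submodule.mem_map_of_mem (hTinv g.1 (hW (q.symm s).2))
      map_add' := fun _ _ ↦ rfl
      map_smul' := fun _ _ ↦ rfl }
  refine false_of_disjoint hM hlift hloc hlen hkill hXJ hU hV bot_le
    (h0.trans_le zero_le_one) hVU.symm disjoint_bot_left (e.trans q).symm (f.trans q).symm χ
    fun g hg ↦ (hkill g).resolve_left ?_
  intro hb
  refine (isSimpleModule_iff_isAtom.1 hWs).1 (le_bot_iff.1 (hWX le_rfl fun w hw ↦ ?_))
  have h : X.mkQ (g.1 (q.symm (q ⟨w, hw⟩))) = 0 :=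
    congrArg Subtype.val (LinearMap.congr_fun hg (q ⟨w, hw⟩))
  rw [q.symm_apply_apply] at h
  exact mem_of_apply_mem hb.1 (hXinv g.1) ((Submodule.Quotient.mk_eq_zero X).1 h)

end Core

section Uniserial

variable {A : Type*} [Ring A] {M N : Type*} [AddCommGroup M] [Module A M] [AddCommGroup N]
  [Module A N]

theorem isUniserialModule_of_injective (f : M →ₗ[A] N) (hf : Function.Injective f)
    (h : IsUniserialModule A N) : IsUniserialModule A M := fun X Y ↦
  (h (X.map f) (Y.map f)).imp (Submodule.map_le_map_iff_of_injective hf _ _).1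
    (Submodule.map_le_map_iff_of_injective hf _ _).1

theorem isUniserialModule_of_surjective (f : M →ₗ[A] N) (hf : Function.Surjective f)
    (h : IsUniserialModule A M) : IsUniserialModule A N := fun X Y ↦
  (h (X.comap f) (Y.comap f)).imp (Submodule.comap_le_comap_iff_of_surjective hf).1
    (Submodule.comap_le_comap_iff_of_surjective hf).1

variable [IsArtinianRing A] [Module.Finite A M]

theorem isSumLocal_submodule {V W : Submodule A M} (hu : IsUniserialModule A (M ⧸ V))
    (hW : W ≠ ⊥) (hV : V ≤ Ring.jacobson A • W) : IsSumLocal A W := by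
  have := Submodule.nontrivial_iff_ne_bot.2 hW
  refine isSumLocal_of_isUniserialModule_quotient (V.comap W.subtype) ?_
    (isUniserialModule_of_injective (Submodule.mapQ _ V W.subtype le_rfl) ?_ hu)
  · rw [← Submodule.map_le_map_iff_of_injective W.injective_subtype, Submodule.map_smul'']
    exact (Submodule.map_comap_le _ _).trans (by simpa using hV)
  · rw [← LinearMap.ker_eq_bot, Submodule.mapQ, Submodule.ker_liftQ_eq_bot]
    rw [LinearMap.ker_comp, Submodule.ker_mkQ]

theorem eq_of_le_sup_jacobson_smul {U W : Submodule A M} (hU : U ≤ W)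
    (h : W ≤ U ⊔ Ring.jacobson A • W) : U = W := by
  have : U.comap W.subtype = ⊤ := by
    refine eq_top_of_sup_jacobson_smul_eq_top (eq_top_iff.2 ?_)
    rw [← Submodule.map_le_map_iff_of_injective W.injective_subtype, Submodule.map_sup,
      Submodule.map_smul'', Submodule.map_comap_subtype, inf_eq_right.2 hU]
    simpa using h
  exact le_antisymm hU (Submodule.comap_subtype_eq_top.1 this)

theorem le_or_eq_radPow {j : ℕ} (hu : IsUniserialModule A (M ⧸ radPow A M j))
    (U : Submodule A M) : U ≤ radPow A M j ∨ ∃ k < j, U = radPow A M k := by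
  have key : ∀ m ≤ j, U ≤ radPow A M m ∨ ∃ k < m, U = radPow A M k := by
    intro m
    induction m with
    | zero => exact fun _ ↦ .inl le_top
    | succ m ih =>
      intro hm
      rcases ih (by omega) with hU | ⟨k, hk, rfl⟩
      · by_cases heq : U = radPow A M m
        · exact .inr ⟨m, by omega, heq⟩
        · have hne : radPow A M m ≠ ⊥ := fun h ↦ heq (h ▸ le_bot_iff.1 (h ▸ hU))
          have hloc := isSumLocal_submodule hu hne (by
            rw [← radPow_succ]
            exact radPow_antitone hm)
          have := hloc.le_jacobson_smul (X := U.comap (radPow A M m).subtype)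
            fun h ↦ heq (le_antisymm hU (Submodule.comap_subtype_eq_top.1 h))
          rw [← Submodule.map_le_map_iff_of_injective (Submodule.injective_subtype _),
            Submodule.map_smul'', Submodule.map_comap_subtype, inf_eq_right.2 hU] at this
          exact .inl (by simpa [radPow_succ] using this)
      · exact .inr ⟨k, by omega, rfl⟩
  exact key j le_rfl

theorem exists_radPow_of_isNFactorSerial (hM : IsSumLocal A M) {i : ℕ}
    (h : IsNFactorSerial A M i) : ∃ j, 1 ≤ j ∧ IsUniserialModule A (M ⧸ radPow A M j) ∧
      ¬ IsUniserialModule A (M ⧸ radPow A M (j + 1)) ∧ len A (radPow A M j) ≤ i := by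
  obtain ⟨-, -, l, hl, hil, hu, hnu⟩ := h
  have := hM.1
  have hl' := len_eq_of_moduleLength_eq hl
  refine ⟨l - i, Nat.one_le_iff_ne_zero.2 fun h0 ↦ hnu ?_, hu, hnu, ?_⟩
  · rw [h0]
    have : Nontrivial (M ⧸ radPow A M 1) := by
      rw [Submodule.Quotient.nontrivial_iff, radPow_one]
      exact jacobson_smul_top_lt.ne
    have hloc := hM.of_surjective (radPow A M 1).mkQ (Submodule.mkQ_surjective _)
    have hbot := jacobson_smul_top_quotient (radPow A M 1) radPow_one.ge
    intro X Y
    by_cases hX : X = ⊤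
    · exact .inr (hX ▸ le_top)
    · exact .inl ((hloc.le_jacobson_smul hX).trans (hbot.le.trans bot_le))
  · have hne (k : ℕ) (hk : k ≤ l - i) : radPow A M (k + 1) < radPow A M k := by
      refine lt_of_le_of_ne (radPow_succ_le k) fun heq ↦ hnu ?_
      have h0 : radPow A M k = ⊥ := by
        refine (eq_of_le_sup_jacobson_smul bot_le ?_).symm
        rw [← radPow_succ, heq]
        exact le_sup_right
      have h1 : radPow A M (l - i) = ⊥ := le_bot_iff.1 (h0 ▸ radPow_antitone hk)
      have h2 : radPow A M (l - i + 1) = radPow A M (l - i) := by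
        rw [h1, ← le_bot_iff, ← h1]
        exact radPow_succ_le _
      rwa [h2]
    have hk : ∀ k ≤ l - i, len A (radPow A M k) + k ≤ l := by
      intro k
      induction k with
      | zero => exact fun _ ↦ (len_top.trans hl').le
      | succ k ih =>
        intro hk
        have := ih (by omega)
        have := len_lt_of_lt (hne k (by omega))
        omega
    have := hk _ le_rfl
    omega

end Uniserial

section Annihilator

variable {A : Type*} [Ring A] {M N : Type*} [AddCommGroup M] [Module A M] [AddCommGroup N]
  [Module A N]

variable (A M) in
/-- The largest submodule annihilated by the Jacobson radical of the ring. -/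
def jacobsonTorsion : Submodule A M where
  carrier := {x | ∀ a ∈ Ring.jacobson A, a • x = 0}
  add_mem' hx hy a ha := by rw [smul_add, hx a ha, hy a ha, add_zero]
  zero_mem' a _ := smul_zero a
  smul_mem' b x hx a ha := by
    rw [smul_smul]
    exact hx _ (Ideal.mul_mem_right b _ ha)

theorem le_jacobsonTorsion_iff {U : Submodule A M} :
    U ≤ jacobsonTorsion A M ↔ Ring.jacobson A • U = ⊥ := by
  rw [← le_bot_iff, Submodule.smul_le]
  exact ⟨fun h a ha x hx ↦ h hx a ha, fun h x hx a ha ↦ h a ha x hx⟩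

theorem jacobsonTorsion_le_comap (f : M →ₗ[A] N) :
    jacobsonTorsion A M ≤ (jacobsonTorsion A N).comap f := fun x hx a ha ↦ by
  rw [← map_smul, hx a ha, map_zero]

theorem moduleSoc_le_jacobsonTorsion : moduleSoc A M ≤ jacobsonTorsion A M := by
  refine sSup_le fun S hS x hx a ha ↦ ?_
  have := isSimpleModule_iff_isAtom.2 hS
  have h := Module.mem_annihilator.1 (IsSemisimpleModule.jacobson_le_annihilator A S ha) ⟨x, hx⟩
  exact congrArg Subtype.val h

variable [IsArtinianRing A] [Module.Finite A M]

theorem not_isUniserialModule_of_two_le_len_moduleSoc (h : 2 ≤ len A (moduleSoc A M)) :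
    ¬ IsUniserialModule A M := by
  intro hu
  have hJ := le_jacobsonTorsion_iff.1 (moduleSoc_le_jacobsonTorsion (A := A) (M := M))
  obtain ⟨U, hU, hUs, -⟩ := exists_isSimpleModule_disjoint hJ (Q := ⊥) fun hle ↦ by
    rw [le_bot_iff.1 hle] at h
    simp [len] at h
  obtain ⟨V, hV, hVs, hVU⟩ := exists_isSimpleModule_disjoint hJ (Q := U) fun hle ↦ by
    have := len_mono hle
    rw [len_eq_one_iff.2 hUs] at this
    omega
  rcases hu U V with h | h
  · exact (isSimpleModule_iff_isAtom.1 hUs).1 (le_bot_iff.1 (hVU h le_rfl))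
  · exact (isSimpleModule_iff_isAtom.1 hVs).1 (le_bot_iff.1 (hVU le_rfl h))

theorem isSumLocal_of_three_le_len_moduleSoc (hM : IsIndecModule A M)
    (hlen : ¬ IsSumLocal A M → len A M ≤ 4) (h : 3 ≤ len A (moduleSoc A M)) : IsSumLocal A M := by
  have hsoc : ∀ C : Submodule A M, IsCoatom C → moduleSoc A M ≤ C := by
    intro C hC
    refine sSup_le fun S hS ↦ ?_
    by_contra hSC
    have hc : IsCompl S C :=
      ⟨hS.not_le_iff_disjoint.1 hSC, codisjoint_iff.2 (hC.2 _ (right_lt_sup.2 hSC))⟩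
    have hC0 := (hM.2 S C hc).resolve_left hS.1
    have : S = ⊤ := by simpa [hC0] using hc.sup_eq_top
    have h1 := len_eq_one_iff.2 (isSimpleModule_iff_isAtom.2 hS)
    rw [this, len_top] at h1
    have := len_mono (le_top : moduleSoc A M ≤ ⊤)
    rw [len_top] at this
    omega
  by_contra hloc
  have h4 := hlen hloc
  have heq : ∀ C : Submodule A M, IsCoatom C → moduleSoc A M = C := by
    intro C hC
    refine eq_of_le_of_not_lt (hsoc C hC) fun hlt ↦ ?_
    have h1 := len_lt_of_lt hlt
    have h2 := len_lt_of_lt (lt_top_iff_ne_top.2 hC.1)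
    rw [len_top] at h2
    omega
  refine hloc ⟨hM.1, fun X Y hXY ↦ ?_⟩
  by_contra! hne
  obtain ⟨C, hC, hXC⟩ := (eq_top_or_exists_le_coatom X).resolve_left hne.1
  obtain ⟨D, hD, hYD⟩ := (eq_top_or_exists_le_coatom Y).resolve_left hne.2
  rw [← heq C hC] at hXC
  rw [← heq D hD] at hYD
  exact hC.1 (heq C hC ▸ top_le_iff.1 (hXY ▸ sup_le hXC hYD))

end Annihilator

section Projective

variable {A : Type*} [Ring A] [IsArtinianRing A]

theorem IsSumLocal.exists_surjective {M : Type*} [AddCommGroup M] [Module A M] [Module.Finite A M]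
    (hM : IsSumLocal A M) : ∃ f : A →ₗ[A] M, Function.Surjective f := by
  have := hM.1
  obtain ⟨x, -, hx⟩ := SetLike.exists_of_lt (jacobson_smul_top_lt (A := A) (M := M))
  refine ⟨LinearMap.toSpanSingleton A M x, LinearMap.range_eq_top.1 ?_⟩
  by_contra h
  exact hx (hM.le_jacobson_smul h ⟨1, by simp⟩)

theorem IsSumLocal.exists_projective {M : Type*} [AddCommGroup M] [Module A M] [Module.Finite A M]
    (hM : IsSumLocal A M) : ∃ P : Submodule A A, Module.Projective A P ∧ IsIndecModule A P ∧
      ∃ f : P →ₗ[A] M, Function.Surjective f := by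
  have := hM.1
  obtain ⟨f, hf⟩ := hM.exists_surjective
  obtain ⟨P, ⟨hP, f, hf⟩, hmin⟩ := IsArtinian.set_has_minimal
    {P : Submodule A A | Module.Projective A P ∧ ∃ f : P →ₗ[A] M, Function.Surjective f}
    ⟨⊤, Module.Projective.of_equiv Submodule.topEquiv.symm, f ∘ₗ Submodule.topEquiv.toLinearMap,
      hf.comp Submodule.topEquiv.surjective⟩
  have key : ∀ U V : Submodule A P, IsCompl U V → U.map f = ⊤ → V = ⊥ := by
    intro U V hUV hU
    have hUp : Module.Projective A U := Module.Projective.of_split U.subtype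
      (U.projectionOnto V hUV) (Submodule.projectionOnto_comp_subtype hUV)
    let e := Submodule.equivMapOfInjective P.subtype P.injective_subtype U
    have hnot := hmin (U.map P.subtype) ⟨Module.Projective.of_equiv e,
      f ∘ₗ U.subtype ∘ₗ e.symm.toLinearMap, fun x ↦ ?_⟩
    · have hUP : U.map P.subtype = P := eq_of_le_of_not_lt (Submodule.map_subtype_le P U) hnot
      have : U = ⊤ := Submodule.map_injective_of_injective P.injective_subtype (by simpa using hUP)
      simpa [this] using hUV.inf_eq_bot
    · obtain ⟨y, hy, rfl⟩ := hU.ge (Submodule.mem_top (x := x))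
      exact ⟨e ⟨y, hy⟩, by simp⟩
  refine ⟨P, hP, ⟨hf.nontrivial, fun U V hUV ↦ ?_⟩, f, hf⟩
  have hsup : U.map f ⊔ V.map f = ⊤ := by
    rw [← Submodule.map_sup, hUV.sup_eq_top, Submodule.map_top, LinearMap.range_eq_top.2 hf]
  exact (hM.2 _ _ hsup).symm.imp (key V U hUV.symm) (key U V hUV)

theorem IsIndecModule.isSumLocal {P : Type*} [AddCommGroup P] [Module A P] [Module.Finite A P]
    [Module.Projective A P] (hP : IsIndecModule A P) : IsSumLocal A P := by
  refine ⟨hP.1, fun X Y hXY ↦ ?_⟩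
  obtain ⟨k, hk⟩ := Module.projective_lifting_property (X.subtype.coprod Y.subtype) LinearMap.id
    (by rw [← LinearMap.range_eq_top, ← Submodule.sup_eq_range, hXY])
  let a : Module.End A P := X.subtype ∘ₗ LinearMap.fst A X Y ∘ₗ k
  let b : Module.End A P := Y.subtype ∘ₗ LinearMap.snd A X Y ∘ₗ k
  have hab : b = 1 - a := by
    refine eq_sub_of_add_eq' (LinearMap.ext fun x ↦ ?_)
    simpa [a, b] using LinearMap.congr_fun hk x
  have hX : Function.Surjective a → X = ⊤ := fun h ↦ eq_top_iff.2 fun x _ ↦ by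
    obtain ⟨y, rfl⟩ := h x
    exact (k y).1.2
  have hY : Function.Surjective b → Y = ⊤ := fun h ↦ eq_top_iff.2 fun x _ ↦ by
    obtain ⟨y, rfl⟩ := h x
    exact (k y).2.2
  obtain ⟨n, hn, hc⟩ := ((Filter.eventually_ge_atTop 1).and
    a.eventually_isCompl_ker_pow_range_pow).exists
  rcases hP.2 _ _ hc with h | h
  · refine .inl (hX (IsArtinian.surjective_of_injective_endomorphism a ?_))
    rw [← LinearMap.ker_eq_bot, ← le_bot_iff, ← h]
    intro x hx
    obtain ⟨m, rfl⟩ := Nat.exists_eq_add_of_le' hn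
    rw [LinearMap.mem_ker, pow_succ, Module.End.mul_apply, LinearMap.mem_ker.1 hx, map_zero]
  · have hnil : IsNilpotent a := ⟨n, LinearMap.range_eq_bot.1 h⟩
    rw [hab] at hY
    exact .inr (hY ((Module.End.isUnit_iff _).1 hnil.isUnit_one_sub).2)

end Projective

section Reduction

variable (R : Type*) [CommRing R] [IsArtinianRing R] {A : Type*} [Ring A] [IsArtinianRing A]
  [Algebra R A] [Module.Finite R A]

theorem len_map_add_len_inf_ker {M N : Type*} [AddCommGroup M] [Module A M] [Module.Finite A M]
    [AddCommGroup N] [Module A N] [Module.Finite A N] (f : M →ₗ[A] N) {V : Submodule A M}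
    (hV : LinearMap.ker f ≤ V) : len A (V.map f) + len A (LinearMap.ker f) = len A V := by
  have h := len_ker_add_range (f.domRestrict V)
  rw [LinearMap.range_domRestrict, LinearMap.ker_domRestrict,
    len_congr (Submodule.comapSubtypeEquivOfLe hV)] at h
  omega

variable {P : Type u} [AddCommGroup P] [Module A P] [Module.Finite A P] [Module R P]
  [IsScalarTower R A P] [Module.Projective A P] (hP : IsSumLocal A P)
  (hloc : ∀ (N : Type u) [AddCommGroup N] [Module A N] [Module.Finite A N], IsIndecModule A N →
    ¬ IsSumLocal A N → len A N ≤ 4)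
include R hP hloc

theorem len_radPow_lt_add_three {j : ℕ} (hj : 1 ≤ j) :
    len A (radPow A P j) < len A (radPow A P (j + 1)) + 3 := by
  by_contra! hlen
  have := hP.1
  let U := radPow A P (j + 1)
  have hmk := Submodule.mkQ_surjective U
  have hU1 : U ≤ Ring.jacobson A • ⊤ := (radPow_antitone (by omega)).trans_eq radPow_one
  have : Nontrivial (P ⧸ U) := Submodule.Quotient.nontrivial_iff.2
    (hU1.trans_lt jacobson_smul_top_lt).ne
  have hloc' : IsSumLocal A (P ⧸ U) := hP.of_surjective U.mkQ hmk
  have hbot : radPow A (P ⧸ U) (j + 1) = ⊥ := by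
    rw [← map_radPow U.mkQ hmk, Submodule.mkQ_map_self]
  have hle1 : radPow A (P ⧸ U) j ≤ Ring.jacobson A • ⊤ := (radPow_antitone hj).trans_eq radPow_one
  have h3 : 3 ≤ len A (radPow A (P ⧸ U) j) := by
    have h := len_map_add_len_inf_ker U.mkQ (V := radPow A P j)
      (U.ker_mkQ.trans_le (radPow_succ_le j))
    rw [map_radPow U.mkQ hmk, Submodule.ker_mkQ] at h
    change _ + len A (radPow A P (j + 1)) = _ at h
    omega
  have h4 : 4 ≤ len A (P ⧸ U) := by
    have := len_lt_of_lt (hle1.trans_lt jacobson_smul_top_lt)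
    rw [len_top] at this
    omega
  refine false_of_three_le_len R hloc' (fun L h ↦ ?_) (fun L ↦ hloc _) h4
    (X := radPow A (P ⧸ U) j) (fun g ↦ ?_) hle1 (by rw [← radPow_succ, hbot]) h3
  · obtain ⟨k, hk⟩ := Module.projective_lifting_property L.mkQ (h ∘ₗ U.mkQ) L.mkQ_surjective
    have hkU : U ≤ LinearMap.ker k := by
      intro x hx
      have h1 := hbot.le (map_radPow_le (LinearMap.fst A _ _ ∘ₗ k) _ ⟨x, hx, rfl⟩)
      have h2 := hbot.le (map_radPow_le (LinearMap.snd A _ _ ∘ₗ k) _ ⟨x, hx, rfl⟩)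
      exact Prod.ext h1 h2
    refine ⟨U.liftQ k hkU, ?_⟩
    ext x
    exact LinearMap.congr_fun hk x
  · refine (hloc'.bijective_or_range_le g).imp_right fun hg x hx ↦ ?_
    exact hbot.le (map_radPow_le_succ g hg j ⟨x, hx, rfl⟩)

theorem len_moduleSoc_le_two_of_surjective {M : Type*} [AddCommGroup M] [Module A M]
    [Module.Finite A M] (f : P →ₗ[A] M) (hf : Function.Surjective f) {i : ℕ} (hi : i ≤ 4)
    (hPi : IsFactorSerial A P i) : len A (moduleSoc A M) ≤ 2 := by
  by_contra! hsoc
  have hnu := not_isUniserialModule_of_two_le_len_moduleSoc (A := A) (M := M) (by omega)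
  have hPi' : IsNFactorSerial A P i :=
    hPi.resolve_left fun h ↦ hnu (isUniserialModule_of_surjective f hf h.2)
  obtain ⟨j, hj, hu, -, hK4⟩ := exists_radPow_of_isNFactorSerial hP hPi'
  have hlt := len_radPow_lt_add_three R hP hloc hj
  have hker : ¬ radPow A P j ≤ LinearMap.ker f := fun h ↦ hnu
    (isUniserialModule_of_surjective ((radPow A P j).liftQ f h)
      (LinearMap.range_eq_top.1 (by rw [Submodule.range_liftQ, LinearMap.range_eq_top.2 hf])) hu)
  have hsmall {U : Submodule A P} (hU : Ring.jacobson A • U ≤ LinearMap.ker f) :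
      U ≤ radPow A P j := by
    refine (le_or_eq_radPow hu U).resolve_right ?_
    rintro ⟨k, hk, rfl⟩
    rw [← radPow_succ] at hU
    exact hker ((radPow_antitone (by omega)).trans hU)
  let V := (moduleSoc A M).comap f
  have hkV : LinearMap.ker f ≤ V := LinearMap.ker_le_comap f
  have hJV : Ring.jacobson A • V ≤ LinearMap.ker f := by
    rw [LinearMap.le_ker_iff_map, Submodule.map_smul'', ← le_jacobsonTorsion_iff]
    exact (Submodule.map_comap_le _ _).trans moduleSoc_le_jacobsonTorsion
  have hVK := hsmall hJV
  have hlenV := len_map_add_len_inf_ker f hkV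
  rw [Submodule.map_comap_eq_of_surjective hf] at hlenV
  have hVK' := len_mono hVK
  have hker0 : LinearMap.ker f = ⊥ := by
    by_contra hne
    have := Submodule.nontrivial_iff_ne_bot.2 hne
    have hpos : 0 < len A (LinearMap.ker f) := len_pos
    have hV : V = radPow A P j := eq_of_le_of_not_lt hVK fun h ↦ by
      have := len_lt_of_lt h
      omega
    rw [hV, ← radPow_succ] at hJV
    have := len_mono hJV
    omega
  let T := jacobsonTorsion A P
  have hJT : Ring.jacobson A • T = ⊥ := le_jacobsonTorsion_iff.1 le_rfl
  have hVT : V ≤ T := le_jacobsonTorsion_iff.2 (le_bot_iff.1 (hker0 ▸ hJV))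
  have hTK : T ≤ radPow A P j := hsmall (hJT.trans_le bot_le)
  have hVT' := len_mono hVT
  have hTK' := len_mono hTK
  have hTne : T ≠ radPow A P j := fun h ↦ by
    rw [radPow_succ, ← h, hJT] at hlt
    have : len A (⊥ : Submodule A P) = 0 := by simp [len]
    omega
  have hTlt := len_lt_of_lt (lt_of_le_of_ne hTK hTne)
  have hXT : radPow A P (j + 1) ≤ T := by
    by_contra hle
    have hsup : radPow A P j = T ⊔ radPow A P (j + 1) :=
      (eq_of_le_of_not_lt (sup_le hTK (radPow_succ_le j)) fun h ↦ by
        have h1 := len_lt_of_lt h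
        have h2 := len_lt_of_lt (left_lt_sup.2 hle)
        omega).symm
    exact hTne (eq_of_le_sup_jacobson_smul hTK (hsup.trans_le (by rw [radPow_succ])))
  have hle1 : radPow A P j ≤ Ring.jacobson A • ⊤ := (radPow_antitone hj).trans_eq radPow_one
  have hJX : Ring.jacobson A • radPow A P (j + 1) = ⊥ := le_jacobsonTorsion_iff.1 hXT
  have h4 : 4 ≤ len A P := by
    have := len_mono (le_top : radPow A P j ≤ ⊤)
    rw [len_top] at this
    omega
  have hlift (L : Submodule A (P × P)) (h : P →ₗ[A] (P × P) ⧸ L) :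
      ∃ k : P →ₗ[A] P × P, L.mkQ ∘ₗ k = h :=
    Module.projective_lifting_property L.mkQ h L.mkQ_surjective
  have hkill (g : P →ₗ[A] P) : Function.Bijective g ∨ radPow A P (j + 1) ≤ LinearMap.ker g := by
    refine (hP.bijective_or_range_le g).imp_right fun hg x hx ↦ ?_
    have := map_radPow_le_succ g hg (j + 1) ⟨x, hx, rfl⟩
    rwa [radPow_succ, hJX] at this
  by_cases h3 : 3 ≤ len A (radPow A P (j + 1))
  · exact false_of_three_le_len R hP hlift (fun L ↦ hloc _) h4 hkill
      ((radPow_succ_le j).trans hle1) hJX h3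
  · exact false_of_len_eq_add_one R hP hlift (fun L ↦ hloc _) h4 hkill hXT (hTK.trans hle1) hJT
      (by omega) (by omega) (fun g ↦ Submodule.map_le_iff_le_comap.1 (map_radPow_le g _))
      jacobsonTorsion_le_comap

end Reduction

end SocleLength

theorem socle_length_le_two
    (R : Type*) [CommRing R] [IsArtinianRing R]
    (Λ : Type u) [Ring Λ] [Algebra R Λ] [Module.Finite R Λ]
    (hΛ : IsRightNNakayama Λ 4)
    (M : Type u) [AddCommGroup M] [Module Λᵐᵒᵖ M] [Module.Finite Λᵐᵒᵖ M]
    (hind : IsIndecModule Λᵐᵒᵖ M) :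
    moduleLength Λᵐᵒᵖ ↑(moduleSoc Λᵐᵒᵖ M) ≤ 2 := by
  have : Module.Finite R Λᵐᵒᵖ := Module.Finite.equiv (MulOpposite.opLinearEquiv R)
  have : IsArtinianRing Λᵐᵒᵖ := IsArtinianRing.of_finite R _
  have hloc (N : Type u) [AddCommGroup N] [Module Λᵐᵒᵖ N] [Module.Finite Λᵐᵒᵖ N]
      (hN : IsIndecModule Λᵐᵒᵖ N) (hNl : ¬ SocleLength.IsSumLocal Λᵐᵒᵖ N) :
      SocleLength.len Λᵐᵒᵖ N ≤ 4 := by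
    obtain ⟨i, -, hi, h⟩ := hΛ.1 (ModuleCat.of Λᵐᵒᵖ N) ‹_› hN
    have := hN.1
    exact (SocleLength.IsFactorSerial.len_le_of_not_isSumLocal h hNl).trans hi
  suffices h : SocleLength.len Λᵐᵒᵖ (moduleSoc Λᵐᵒᵖ M) ≤ 2 by
    rw [SocleLength.moduleLength_eq]
    exact WithBot.coe_le_coe.2 (Nat.cast_le.2 h)
  by_contra! h
  have hM := SocleLength.isSumLocal_of_three_le_len_moduleSoc hind (hloc M hind) h
  obtain ⟨P, hproj, hP, f, hf⟩ := hM.exists_projective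
  obtain ⟨i, -, hi, hPi⟩ := hΛ.1 (ModuleCat.of Λᵐᵒᵖ P) inferInstance hP
  have hPl := SocleLength.IsIndecModule.isSumLocal hP
  exact absurd (SocleLength.len_moduleSoc_le_two_of_surjective R hPl hloc f hf hi hPi) (by omega)
end

section
/- Let Λ be a right 4-Nakayama artin algebra and let M be a finitely generated indecomposable 4-factor serial right Λ-module. If M is local and rad(M) is indecomposable, then soc(M) is simple. -/
/-! Basic definitions for (right) modules over a ring: radical, socle, length,
uniserial, local, indecomposable, `n`-factor serial, right `n`-Nakayama algebras,
Nakayama algebras and almost split sequences. -/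

universe u v w

section Auxiliary

variable {A : Type v} [Ring A]

theorem radPow_succ_le_moduleRad (M : Type w) [AddCommGroup M] [Module A M] (n : ℕ) :
    radPow A M (n + 1) ≤ moduleRad A M :=
  Module.map_jacobson_le (radPow A M n).subtype

theorem radPow_one_eq_moduleRad (M : Type w) [AddCommGroup M] [Module A M] :
    radPow A M 1 = moduleRad A M :=
  Module.map_jacobson_of_bijective (f := (⊤ : Submodule A M).subtype)
    ⟨Subtype.val_injective, fun x => ⟨⟨x, trivial⟩, rfl⟩⟩

/-- If a quotient of `M` by a submodule of its radical is uniserial, then `M` has at most one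
maximal submodule. -/
theorem eq_of_isCoatom_of_isUniserialModule_quotient {M : Type w} [AddCommGroup M] [Module A M]
    {K a b : Submodule A M} (hK : K ≤ moduleRad A M) (h : IsUniserialModule A (M ⧸ K))
    (ha : IsCoatom a) (hb : IsCoatom b) : a = b := by
  have hcomap : ∀ c : Submodule A M, IsCoatom c → (c.map K.mkQ).comap K.mkQ = c := fun c hc => by
    rw [Submodule.comap_map_mkQ]
    exact sup_eq_right.2 (hK.trans (sInf_le hc))
  rcases h (a.map K.mkQ) (b.map K.mkQ) with h | h
  · have := Submodule.comap_mono (f := K.mkQ) h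
    rw [hcomap a ha, hcomap b hb] at this
    exact (ha.le_iff.1 this).elim (fun h => (hb.1 h).elim) fun h => h.symm
  · have := Submodule.comap_mono (f := K.mkQ) h
    rw [hcomap a ha, hcomap b hb] at this
    exact (hb.le_iff.1 this).elim (fun h => (ha.1 h).elim) fun h => h

theorem IsFactorSerial.eq_of_isCoatom {M : Type w} [AddCommGroup M] [Module A M] {i : ℕ}
    (h : IsFactorSerial A M i) (hi : (i : ℕ∞) < Module.length A M) {a b : Submodule A M}
    (ha : IsCoatom a) (hb : IsCoatom b) : a = b := by
  rcases h with ⟨-, h⟩ | ⟨-, -, l, hl, hil, h, -⟩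
  · rcases h a b with h | h
    · exact (ha.le_iff.1 h).elim (fun h => (hb.1 h).elim) fun h => h.symm
    · exact (hb.le_iff.1 h).elim (fun h => (ha.1 h).elim) fun h => h
  · have hl' : Module.length A M = l := by
      have := (Module.coe_length A M).trans hl
      exact_mod_cast this
    rw [hl'] at hi
    have hi' : i < l := by exact_mod_cast hi
    obtain ⟨k, hk⟩ : ∃ k, l - i = k + 1 := ⟨l - i - 1, by omega⟩
    rw [hk] at h
    exact eq_of_isCoatom_of_isUniserialModule_quotient (radPow_succ_le_moduleRad M k) h ha hb

/-- Let `j : M → X` be an injective map whose image is a maximal submodule and maps the radical of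
`M` onto the radical of `X`. If `M` is local with indecomposable radical and `X` is decomposable,
then `j` splits. -/
theorem exists_retraction_of_not_isIndecModule {M : Type*} [AddCommGroup M] [Module A M]
    {X : Type*} [AddCommGroup X] [Module A X] (j : M →ₗ[A] X) (hj : Function.Injective j)
    (hrange : IsCoatom (LinearMap.range j)) {L : Submodule A M} (hL : IsIndecModule A L)
    (hmax : ∀ K : Submodule A M, K ≠ ⊤ → K ≤ L) (hrad : moduleRad A X = L.map j)
    (hX : ¬ IsIndecModule A X) : ∃ r : X →ₗ[A] M, r ∘ₗ j = LinearMap.id := by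
  have key : ∀ X₁ X₂ : Submodule A X, IsCompl X₁ X₂ → X₂ ≠ ⊥ →
      X₂.comap (j ∘ₗ L.subtype) = ⊥ → ∃ r : X →ₗ[A] M, r ∘ₗ j = LinearMap.id := by
    intro X₁ X₂ _ hne hbot
    have hmem : ∀ m ∈ L, j m ∈ X₂ → m = 0 := fun m hm hmX => by
      have : (⟨m, hm⟩ : L) ∈ X₂.comap (j ∘ₗ L.subtype) := hmX
      rw [hbot] at this
      exact congrArg Subtype.val ((Submodule.mem_bot A).1 this)
    have hK : X₂.comap j ≤ L := hmax _ fun htop => by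
      obtain ⟨x, hx⟩ := @exists_ne L hL.1 0
      refine hx (Subtype.ext (hmem x x.2 ?_))
      exact (htop ▸ Submodule.mem_top : (x : M) ∈ X₂.comap j)
    have hdisj : Disjoint (LinearMap.range j) X₂ := by
      rw [Submodule.disjoint_def]
      rintro _ ⟨m, rfl⟩ hm
      rw [hmem m (hK hm) hm, map_zero]
    have hcompl : IsCompl (LinearMap.range j) X₂ := by
      refine ⟨hdisj, codisjoint_iff.2 (hrange.2 _ (left_lt_sup.2 fun hle => hne ?_))⟩
      exact hdisj.symm.eq_bot_of_le hle
    refine ⟨(LinearEquiv.ofInjective j hj).symm.toLinearMap ∘ₗ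
      Submodule.projectionOnto _ _ hcompl, LinearMap.ext fun m => ?_⟩
    have : Submodule.projectionOnto _ _ hcompl (j m) = LinearEquiv.ofInjective j hj m :=
      Submodule.projectionOnto_apply_of_mem_left hcompl ⟨m, rfl⟩
    simp [this]
  obtain ⟨l, hl⟩ := @exists_ne L hL.1 0
  have hnt : Nontrivial X := ⟨j l, 0, fun h => hl (Subtype.ext (hj (h.trans (map_zero j).symm)))⟩
  simp only [IsIndecModule, hnt, true_and] at hX
  push Not at hX
  obtain ⟨X₁, X₂, hc, h₁, h₂⟩ := hX
  have hproj : ∀ (P Q : Submodule A X) (h : IsCompl P Q) (l : L),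
      ∃ l' : L, j l' = P.projection Q h (j l) := fun P Q h l => by
    have : P.projection Q h (j l) ∈ moduleRad A X :=
      Module.le_comap_jacobson (P.projection Q h)
        (show j l ∈ moduleRad A X from hrad ▸ Submodule.mem_map_of_mem l.2)
    rw [hrad] at this
    obtain ⟨m, hm, hml⟩ := this
    exact ⟨⟨m, hm⟩, hml⟩
  have hcompl : IsCompl (X₁.comap (j ∘ₗ L.subtype)) (X₂.comap (j ∘ₗ L.subtype)) := by
    constructor
    · rw [Submodule.disjoint_def]
      intro x hx₁ hx₂
      have : j x = 0 := Submodule.disjoint_def.1 hc.disjoint _ hx₁ hx₂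
      exact Subtype.ext (hj (this.trans (map_zero j).symm))
    · rw [codisjoint_iff, eq_top_iff]
      intro x _
      obtain ⟨x₁, hx₁⟩ := hproj X₁ X₂ hc x
      obtain ⟨x₂, hx₂⟩ := hproj X₂ X₁ hc.symm x
      have hsum : x₁ + x₂ = x := by
        refine Subtype.ext (hj ?_)
        rw [Submodule.coe_add, map_add, hx₁, hx₂]
        exact Submodule.projection_add_projection_eq_self hc _
      rw [← hsum]
      refine Submodule.add_mem_sup ?_ ?_
      · exact (hx₁ ▸ Submodule.projection_apply_mem hc _ : j x₁ ∈ X₁)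
      · exact (hx₂ ▸ Submodule.projection_apply_mem hc.symm _ : j x₂ ∈ X₂)
  rcases hL.2 _ _ hcompl with h | h
  · exact key X₂ X₁ hc.symm h₁ h
  · exact key X₁ X₂ hc h₂ h

/-- Suppose that every indecomposable module of length greater than `n` has at most one maximal
submodule, and let `M` be a local module of length at least `n` whose radical `L` is indecomposable.
Then every map to `L` from a maximal submodule of a module `N` extends to a map `N → M`. -/
theorem exists_extension_of_isCoatom {n : ℕ∞}
    (hS : ∀ (X : Type u) [AddCommGroup X] [Module A X], Module.Finite A X → IsIndecModule A X →
      n < Module.length A X → ∀ a b : Submodule A X, IsCoatom a → IsCoatom b → a = b)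
    {M : Type u} [AddCommGroup M] [Module A M] [IsArtinian A M] [IsNoetherian A M]
    (hn : n ≤ Module.length A M) {L : Submodule A M} (hLrad : moduleRad A M = L)
    (hLmax : IsCoatom L) (hL : IsIndecModule A L) (hmax : ∀ K : Submodule A M, K ≠ ⊤ → K ≤ L)
    {N : Type u} [AddCommGroup N] [Module A N] [IsArtinian A N] [IsNoetherian A N]
    {Q : Submodule A N} (hQ : IsCoatom Q) (p : Q →ₗ[A] L) :
    ∃ φ : N →ₗ[A] M, ∀ q : Q, φ q = p q := by
  let W : Submodule A (M × N) := LinearMap.range ((L.subtype ∘ₗ p).prod (-Q.subtype))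
  let j : M →ₗ[A] (M × N) ⧸ W := W.mkQ ∘ₗ LinearMap.inl A M N
  let k : N →ₗ[A] (M × N) ⧸ W := W.mkQ ∘ₗ LinearMap.inr A M N
  have hkj : ∀ q : Q, k q = j (p q) := fun q => by
    refine ((Submodule.Quotient.eq W).2 ⟨-q, ?_⟩)
    simp
  have hjk : ∀ m y, j m = k y → ∃ q : Q, (q : N) = y ∧ (p q : M) = m := fun m y h => by
    obtain ⟨q, hq⟩ := (Submodule.Quotient.eq W).1 h
    refine ⟨q, ?_, ?_⟩
    · simpa using congrArg Prod.snd hq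
    · simpa using congrArg Prod.fst hq
  have hsurj : ∀ x, ∃ m y, x = j m + k y := fun x => by
    obtain ⟨⟨m, y⟩, rfl⟩ := W.mkQ_surjective x
    refine ⟨m, y, ?_⟩
    change _ = W.mkQ (m, 0) + W.mkQ (0, y)
    rw [← map_add]
    simp
  have hj : Function.Injective j := (injective_iff_map_eq_zero j).2 fun m hm => by
    obtain ⟨q, hq, rfl⟩ := hjk m 0 (by rw [hm, map_zero])
    rw [show q = 0 from Subtype.ext hq, map_zero, Submodule.coe_zero]
  have hkQ : ∀ y, k y ∈ LinearMap.range j ↔ y ∈ Q := fun y => by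
    constructor
    · rintro ⟨m, hm⟩
      obtain ⟨q, rfl, -⟩ := hjk m y hm
      exact q.2
    · exact fun hy => ⟨_, (hkj ⟨y, hy⟩).symm⟩
  have hjL : ∀ m, j m ∈ L.map j ⊔ LinearMap.range k ↔ m ∈ L := fun m => by
    constructor
    · intro h
      obtain ⟨_, ⟨l, hl, rfl⟩, _, ⟨y, rfl⟩, h⟩ := Submodule.mem_sup.1 h
      obtain ⟨q, -, hq⟩ := hjk (m - l) y (by rw [map_sub, ← h, add_sub_cancel_left])
      rw [← sub_add_cancel m l, ← hq]
      exact L.add_mem (p q).2 hl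
    · exact fun h => Submodule.mem_sup_left (Submodule.mem_map_of_mem h)
  have ha : IsCoatom (LinearMap.range j) := by
    refine ⟨fun h => hQ.1 (eq_top_iff.2 fun y _ => (hkQ y).1 (h ▸ Submodule.mem_top)),
      fun c hc => ?_⟩
    obtain ⟨x, hx, hxa⟩ := SetLike.exists_of_lt hc
    obtain ⟨m, y, rfl⟩ := hsurj x
    have hjc : ∀ m, j m ∈ c := fun m => hc.le ⟨m, rfl⟩
    have hlt : Q < c.comap k := by
      refine SetLike.lt_iff_le_and_exists.2 ⟨fun y hy => hc.le ((hkQ y).2 hy), y,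
        (Submodule.add_mem_iff_right _ (hjc m)).1 hx, fun hy => hxa ?_⟩
      exact Submodule.add_mem _ ⟨m, rfl⟩ ((hkQ y).2 hy)
    refine eq_top_iff.2 fun x _ => ?_
    obtain ⟨m, y, rfl⟩ := hsurj x
    exact c.add_mem (hjc m) (show y ∈ c.comap k from hQ.2 _ hlt ▸ Submodule.mem_top)
  have hb : IsCoatom (L.map j ⊔ LinearMap.range k) := by
    refine ⟨fun h => hLmax.1 (eq_top_iff.2 fun m _ => (hjL m).1 (h ▸ Submodule.mem_top)),
      fun c hc => ?_⟩
    obtain ⟨x, hx, hxb⟩ := SetLike.exists_of_lt hc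
    obtain ⟨m, y, rfl⟩ := hsurj x
    have hkc : ∀ y, k y ∈ c := fun y => hc.le (Submodule.mem_sup_right ⟨y, rfl⟩)
    have hlt : L < c.comap j := by
      refine SetLike.lt_iff_le_and_exists.2 ⟨fun m hm => hc.le ((hjL m).2 hm), m,
        (Submodule.add_mem_iff_left _ (hkc y)).1 hx, fun hm => hxb ?_⟩
      exact Submodule.add_mem _ ((hjL m).2 hm) (Submodule.mem_sup_right ⟨y, rfl⟩)
    refine eq_top_iff.2 fun x _ => ?_
    obtain ⟨m, y, rfl⟩ := hsurj x
    exact c.add_mem (show m ∈ c.comap j from hLmax.2 _ hlt ▸ Submodule.mem_top) (hkc y)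
  have hrad : moduleRad A ((M × N) ⧸ W) = L.map j := by
    refine le_antisymm (fun x hx => ?_) ?_
    · have hle : ∀ c, IsCoatom c → moduleRad A ((M × N) ⧸ W) ≤ c := fun c hc => sInf_le hc
      obtain ⟨m, rfl⟩ := hle _ ha hx
      exact Submodule.mem_map_of_mem ((hjL m).1 (hle _ hb hx))
    · rw [← hLrad]
      exact Module.map_jacobson_le j
  have hlen : n < Module.length A ((M × N) ⧸ W) := by
    refine lt_of_le_of_lt hn ?_
    rw [(LinearEquiv.ofInjective j hj).length_eq]
    exact Submodule.length_lt ha.1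
  have hX : ¬ IsIndecModule A ((M × N) ⧸ W) := fun hX => by
    have hab := hS _ inferInstance hX hlen _ _ ha hb
    refine hQ.1 (eq_top_iff.2 fun y _ => (hkQ y).1 ?_)
    rw [hab]
    exact Submodule.mem_sup_right ⟨y, rfl⟩
  obtain ⟨r, hr⟩ := exists_retraction_of_not_isIndecModule j hj ha hL hmax hrad hX
  exact ⟨r ∘ₗ k, fun q => by
    rw [LinearMap.comp_apply, hkj]
    exact LinearMap.congr_fun hr _⟩

/-- Under the hypotheses of `exists_extension_of_isCoatom`, the radical `L` is quasi-injective. -/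
theorem exists_extension_of_submodule {n : ℕ∞}
    (hS : ∀ (X : Type u) [AddCommGroup X] [Module A X], Module.Finite A X → IsIndecModule A X →
      n < Module.length A X → ∀ a b : Submodule A X, IsCoatom a → IsCoatom b → a = b)
    {M : Type u} [AddCommGroup M] [Module A M] [IsArtinian A M] [IsNoetherian A M]
    (hn : n ≤ Module.length A M) {L : Submodule A M} (hLrad : moduleRad A M = L)
    (hLmax : IsCoatom L) (hL : IsIndecModule A L) (hmax : ∀ K : Submodule A M, K ≠ ⊤ → K ≤ L)
    (Q : Submodule A L) (p : Q →ₗ[A] L) :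
    ∃ φ : L →ₗ[A] L, ∀ q : Q, φ q = p q := by
  induction Q using WellFoundedGT.induction with
  | ind Q ih =>
  rcases eq_or_ne Q ⊤ with rfl | hQ
  · exact ⟨p ∘ₗ Submodule.topEquiv.symm.toLinearMap, fun q => rfl⟩
  obtain ⟨P, hQP, -⟩ := exists_covBy_le_of_lt hQ.lt_top
  have hQ' : IsCoatom (Q.comap P.subtype) := by
    refine ⟨fun h => hQP.lt.not_ge fun x hx => ?_, fun c hc => ?_⟩
    · exact (h ▸ Submodule.mem_top : (⟨x, hx⟩ : P) ∈ Q.comap P.subtype)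
    · have hlt : Q < c.map P.subtype := by
        obtain ⟨x, hx, hxQ⟩ := SetLike.exists_of_lt hc
        refine SetLike.lt_iff_le_and_exists.2
          ⟨fun q hq => ?_, x.1, Submodule.mem_map_of_mem hx, hxQ⟩
        exact ⟨⟨q, hQP.le hq⟩, hc.le hq, rfl⟩
      have hP : P ≤ c.map P.subtype :=
        (hQP.eq_or_eq hlt.le (Submodule.map_subtype_le P c)).resolve_left hlt.ne' |>.ge
      refine eq_top_iff.2 fun x _ => ?_
      obtain ⟨y, hy, hyx⟩ := hP x.2
      rwa [← Subtype.ext hyx]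
  obtain ⟨φ, hφ⟩ := exists_extension_of_isCoatom hS hn hLrad hLmax hL hmax hQ'
    (p ∘ₗ (Submodule.comapSubtypeEquivOfLe hQP.le).toLinearMap)
  have hrange : LinearMap.range φ ≤ L := hmax _ fun htop => by
    have h₁ := Module.length_le_of_surjective φ (LinearMap.range_eq_top.1 htop)
    have h₂ := Module.length_le_of_injective P.subtype P.subtype_injective
    exact (h₁.trans h₂).not_gt (Submodule.length_lt hLmax.1)
  obtain ⟨ψ, hψ⟩ := ih P hQP.lt (φ.codRestrict L fun x => hrange ⟨x, rfl⟩)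
  refine ⟨ψ, fun q => ?_⟩
  rw [hψ ⟨q, hQP.le q.2⟩]
  exact Subtype.ext (hφ ⟨⟨q, hQP.le q.2⟩, q.2⟩)

/-- In an indecomposable quasi-injective module of finite length, any two nonzero submodules
intersect nontrivially. -/
theorem eq_bot_or_eq_bot_of_disjoint_of_quasiInjective {L : Type*} [AddCommGroup L] [Module A L]
    [IsArtinian A L] [IsNoetherian A L] (hL : IsIndecModule A L)
    (hext : ∀ (Q : Submodule A L) (p : Q →ₗ[A] L), ∃ φ : L →ₗ[A] L, ∀ q : Q, φ q = p q)
    {C D : Submodule A L} (hCD : Disjoint C D) : C = ⊥ ∨ D = ⊥ := by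
  let s : C × D →ₗ[A] L := C.subtype.coprod D.subtype
  have hs : Function.Injective s := (injective_iff_map_eq_zero s).2 fun ⟨c, d⟩ h => by
    have h' : (c : L) = -d := eq_neg_of_add_eq_zero_left (by simpa [s] using h)
    have hc : (c : L) = 0 := Submodule.disjoint_def.1 hCD _ c.2 (h' ▸ D.neg_mem d.2)
    have hd : (d : L) = 0 := neg_eq_zero.1 (h'.symm.trans hc)
    exact Prod.ext (Subtype.ext hc) (Subtype.ext hd)
  obtain ⟨φ, hφ⟩ := hext (LinearMap.range s)
    (D.subtype ∘ₗ LinearMap.snd A C D ∘ₗ (LinearEquiv.ofInjective s hs).symm.toLinearMap)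
  have hφs : ∀ x : C × D, φ (s x) = x.2 := fun x => by
    have := hφ (LinearEquiv.ofInjective s hs x)
    simpa using this
  have hφC : ∀ c ∈ C, φ c = 0 := fun c hc => by simpa [s] using hφs (⟨c, hc⟩, 0)
  have hφD : ∀ d ∈ D, φ d = d := fun d hd => by simpa [s] using hφs (0, ⟨d, hd⟩)
  obtain ⟨n, hn, hcompl⟩ := ((Filter.eventually_ge_atTop 1).and
    (LinearMap.eventually_isCompl_ker_pow_range_pow φ)).exists
  have hφDn : ∀ d ∈ D, (φ ^ n) d = d := fun d hd => by
    rw [Module.End.pow_apply]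
    exact Function.iterate_fixed (hφD d hd) n
  have hφCn : ∀ c ∈ C, (φ ^ n) c = 0 := fun c hc => by
    obtain ⟨k, rfl⟩ := Nat.exists_eq_add_of_le' hn
    rw [pow_succ, Module.End.mul_apply, hφC c hc, map_zero]
  rcases hL.2 _ _ hcompl with h | h
  · exact Or.inl (eq_bot_iff.2 fun c hc => h ▸ hφCn c hc)
  · exact Or.inr (eq_bot_iff.2 fun d hd => h ▸ ⟨d, hφDn d hd⟩)

/-- If any two nonzero submodules of the unique maximal submodule `L ≠ 0` of an artinian module
intersect nontrivially, then the module is colocal. -/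
theorem isColocalModule_of_uniform_maximal {M : Type*} [AddCommGroup M] [Module A M]
    [IsArtinian A M] {L : Submodule A M} (hL : Nontrivial L)
    (hLmax : IsCoatom L) (hmax : ∀ K : Submodule A M, K ≠ ⊤ → K ≤ L)
    (huni : ∀ C D : Submodule A L, Disjoint C D → C = ⊥ ∨ D = ⊥) : IsColocalModule A M := by
  have hLbot : L ≠ ⊥ := (Submodule.nontrivial_iff_ne_bot).1 hL
  obtain ⟨C, hC, hCL⟩ := (eq_bot_or_exists_atom_le L).resolve_left hLbot
  have hatom : ∀ D : Submodule A M, IsAtom D → D ≤ L := fun D hD => hmax D fun h => by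
    subst h
    exact (hD.le_iff.1 (le_top : L ≤ ⊤)).elim hLbot hLmax.1
  have hcomap : ∀ D : Submodule A M, IsAtom D → D.comap L.subtype ≠ ⊥ := fun D hD h => by
    have := Submodule.map_comap_eq_of_le (f := L.subtype) (p := D) (by simpa using hatom D hD)
    rw [h, Submodule.map_bot] at this
    exact hD.1 this.symm
  have huniq : ∀ D : Submodule A M, IsAtom D → D = C := fun D hD => by
    by_contra hne
    have hdisj : Disjoint (D.comap L.subtype) (C.comap L.subtype) := by
      rw [Submodule.disjoint_def]
      exact fun x hx hy => Subtype.ext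
        (Submodule.disjoint_def.1 (hD.disjoint_of_ne hC hne) x hx hy)
    exact (huni _ _ hdisj).elim (hcomap D hD) (hcomap C hC)
  have hsoc : moduleSoc A M = C :=
    le_antisymm (sSup_le fun D hD => (huniq D hD).le) (le_sSup hC)
  rw [IsColocalModule, hsoc]
  exact hC

end Auxiliary

theorem local_four_factor_serial_with_indecomposable_radical_is_colocal
    (R : Type*) [CommRing R] [IsArtinianRing R]
    (Λ : Type u) [Ring Λ] [Algebra R Λ] [Module.Finite R Λ]
    (hΛ : IsRightNNakayama Λ 4)
    (M : Type u) [AddCommGroup M] [Module Λᵐᵒᵖ M] [Module.Finite Λᵐᵒᵖ M]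
    (hind : IsIndecModule Λᵐᵒᵖ M) (hfs : IsNFactorSerial Λᵐᵒᵖ M 4)
    (hloc : IsLocalModule Λᵐᵒᵖ M)
    (hrad : IsIndecModule Λᵐᵒᵖ ↑(radPow Λᵐᵒᵖ M 1)) :
    IsColocalModule Λᵐᵒᵖ M := by
  obtain ⟨-, -, l, hl, h4l, -⟩ := hfs
  have hl' : Module.length Λᵐᵒᵖ M = l := by
    have := (Module.coe_length Λᵐᵒᵖ M).trans hl
    exact_mod_cast this
  have hfin : IsFiniteLength Λᵐᵒᵖ M :=
    Module.length_ne_top_iff.1 (hl' ▸ ENat.natCast_ne_top l)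
  obtain ⟨_, _⟩ := isFiniteLength_iff_isNoetherian_isArtinian.1 hfin
  have hn : ((4 : ℕ) : ℕ∞) ≤ Module.length Λᵐᵒᵖ M := by
    rw [hl']
    exact_mod_cast h4l
  have hS : ∀ (X : Type u) [AddCommGroup X] [Module Λᵐᵒᵖ X], Module.Finite Λᵐᵒᵖ X →
      IsIndecModule Λᵐᵒᵖ X → ((4 : ℕ) : ℕ∞) < Module.length Λᵐᵒᵖ X →
      ∀ a b : Submodule Λᵐᵒᵖ X, IsCoatom a → IsCoatom b → a = b := by
    intro X _ _ hX hXind hlen a b ha hb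
    obtain ⟨i, -, hi, h⟩ := hΛ.1 (ModuleCat.of Λᵐᵒᵖ X) hX hXind
    exact h.eq_of_isCoatom (lt_of_le_of_lt (Nat.cast_le.2 hi) hlen) ha hb
  obtain ⟨L, hLmax, hLuniq⟩ := hloc
  have hLrad : moduleRad Λᵐᵒᵖ M = L :=
    le_antisymm (sInf_le hLmax) (le_sInf fun N hN => (hLuniq N hN).ge)
  have hmax : ∀ K : Submodule Λᵐᵒᵖ M, K ≠ ⊤ → K ≤ L := fun K hK => by
    obtain ⟨N, hN, hKN⟩ := (eq_top_or_exists_le_coatom K).resolve_left hK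
    exact hLuniq N hN ▸ hKN
  rw [radPow_one_eq_moduleRad, hLrad] at hrad
  exact isColocalModule_of_uniform_maximal hrad.1 hLmax hmax fun C D hCD =>
    eq_bot_or_eq_bot_of_disjoint_of_quasiInjective hrad
      (exists_extension_of_submodule hS hn hLrad hLmax hrad hmax) hCD
end

section
/- Let Λ be a right 4-Nakayama artin algebra and let M be a finitely generated indecomposable 4-factor serial right Λ-module. If M is not local, then l(top(M)) = 2, i.e. M/rad(M) has composition length 2. -/
/-! Basic definitions for (right) modules over a ring: radical, socle, length,
uniserial, local, indecomposable, `n`-factor serial, right `n`-Nakayama algebras,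
Nakayama algebras and almost split sequences. -/

universe u v w

section EssentialSimple

open Module

variable {B M X : Type*} [Ring B] [AddCommGroup M] [Module B M] [AddCommGroup X] [Module B X]

/-- A simple submodule contained in every nonzero submodule. -/
structure IsEssentialSimple (S : Submodule B M) : Prop where
  isSimpleModule : IsSimpleModule B S
  le_of_ne_bot : ∀ C : Submodule B M, C ≠ ⊥ → S ≤ C

/-- The inclusion of a submodule `S` into a submodule covering it. -/
abbrev CovBy.incl {S U : Submodule B M} (h : S ⋖ U) : S →ₗ[B] U := Submodule.inclusion h.le

theorem ENat.eq_zero_of_add_le_left {a b : ℕ∞} (ha : a ≠ ⊤) (h : a + b ≤ a) : b = 0 := by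
  have h' : a + b ≤ a + 0 := by rwa [add_zero]
  exact le_zero_iff.1 ((ENat.add_le_add_iff_left ha).1 h')

theorem length_of_covBy {S U : Submodule B M} [IsSimpleModule B S] (h : S ⋖ U) :
    Module.length B U = 2 := by
  have := (covBy_iff_quot_is_simple h.le).1 h
  rw [Module.length_eq_add_of_exact h.incl (Submodule.comap U.subtype S).mkQ
    (Submodule.inclusion_injective _) (Submodule.mkQ_surjective _), Module.length_eq_one,
    Module.length_eq_one, one_add_one_eq_two]
  rw [LinearMap.exact_iff, Submodule.ker_mkQ, Submodule.range_inclusion]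

theorem bijective_of_length_le {Y : Type*} [AddCommGroup Y] [Module B Y] (f : X →ₗ[B] Y)
    (hf : Function.Injective f) (hX : Module.length B X ≠ ⊤)
    (h : Module.length B Y ≤ Module.length B X) : Function.Bijective f := by
  refine ⟨hf, ?_⟩
  have hY := Module.length_eq_add_of_exact f (LinearMap.range f).mkQ hf
    (Submodule.mkQ_surjective _) (LinearMap.exact_map_mkQ_range f)
  have h0 : Module.length B (Y ⧸ LinearMap.range f) = 0 := by
    rw [hY] at h
    exact ENat.eq_zero_of_add_le_left hX h
  rw [Module.length_eq_zero_iff, Submodule.Quotient.subsingleton_iff] at h0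
  exact LinearMap.range_eq_top.1 h0

namespace IsEssentialSimple

variable {S U V : Submodule B M} (hS : IsEssentialSimple S)
include hS

theorem exists_ne_zero : ∃ s : S, s ≠ 0 :=
  have := hS.isSimpleModule.nontrivial
  exists_ne 0

theorem injective_of_apply_ne_zero (hU : S ≤ U) (f : U →ₗ[B] X) (s : S)
    (hs : f (Submodule.inclusion hU s) ≠ 0) : Function.Injective f := by
  rw [← LinearMap.ker_eq_bot]
  by_contra hk
  have h := hS.le_of_ne_bot ((LinearMap.ker f).map U.subtype) fun h ↦
    hk (Submodule.map_injective_of_injective U.injective_subtype (h.trans (Submodule.map_bot _).symm))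
  obtain ⟨u, hu, hus⟩ := h s.2
  have : Submodule.inclusion hU s = u := Subtype.ext hus.symm
  exact hs (this ▸ hu)

theorem bijective_of_apply_ne_zero (hU : S ⋖ U) (f : U →ₗ[B] X) (hX : Module.length B X ≤ 2)
    (s : S) (hs : f (hU.incl s) ≠ 0) : Function.Bijective f := by
  have := hS.isSimpleModule
  have hl := length_of_covBy hU
  exact bijective_of_length_le f (hS.injective_of_apply_ne_zero hU.le f s hs)
    (by rw [hl]; exact ENat.ofNat_ne_top _) (by rwa [hl])

theorem apply_mem (f : S →ₗ[B] M) (s : S) : f s ∈ S := by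
  have := hS.isSimpleModule
  rcases eq_or_ne f 0 with rfl | hf
  · simp
  have hinj := LinearMap.injective_of_ne_zero hf
  have hr : S ≤ LinearMap.range f := hS.le_of_ne_bot _ fun h ↦ hf (LinearMap.range_eq_bot.1 h)
  have : IsSimpleModule B (LinearMap.range f) :=
    IsSimpleModule.congr (LinearEquiv.ofInjective f hinj).symm
  have hat : IsAtom (LinearMap.range f) := isSimpleModule_iff_isAtom.1 this
  have hne : S ≠ ⊥ := (isSimpleModule_iff_isAtom.1 hS.isSimpleModule).1
  exact ((hat.le_iff.1 hr).resolve_left hne).ge ⟨s, rfl⟩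

theorem apply_mem_of_eq_zero (hU : S ⋖ U) (f : U →ₗ[B] M) (hf : ∀ s, f (hU.incl s) = 0) (u : U) :
    f u ∈ S := by
  have hle : S ≤ (S.comap f).map U.subtype := fun s hs ↦
    ⟨hU.incl ⟨s, hs⟩, by simp [hf], rfl⟩
  rcases hU.eq_or_eq hle (Submodule.map_subtype_le _ _) with h | h
  · by_cases hr : LinearMap.range f = ⊥
    · simp [LinearMap.range_eq_bot.1 hr]
    obtain ⟨s, hs⟩ := hS.exists_ne_zero
    obtain ⟨v, hv⟩ := hS.le_of_ne_bot _ hr s.2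
    have hvS : (v : M) ∈ S := by
      rw [← h]
      exact ⟨v, by simp [hv], rfl⟩
    have hs0 : (s : M) = 0 := hv.symm.trans (hf ⟨v, hvS⟩)
    exact absurd (Subtype.ext hs0) hs
  · obtain ⟨v, hv, hvu⟩ := h.ge u.2
    rwa [← Subtype.ext hvu]

theorem apply_eq_zero_of_mem (hU : S ⋖ U) (f : U →ₗ[B] M) (hf : ∀ u, f u ∈ S) (s : S) :
    f (hU.incl s) = 0 := by
  have := hS.isSimpleModule
  by_contra hs
  have hinj : Function.Injective (f.codRestrict S hf) := fun a b hab ↦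
    hS.injective_of_apply_ne_zero hU.le f s hs (congrArg Subtype.val hab)
  have h := Module.length_le_of_injective _ hinj
  rw [length_of_covBy hU, Module.length_eq_one] at h
  exact absurd h (by decide)

end IsEssentialSimple

variable (R : Type*) [CommRing R] [Algebra R B] [Module R M] [IsScalarTower R B M]

/-- The endomorphisms of `S` that extend to homomorphisms `U → V`. -/
def extendableEnd {S U V : Submodule B M} (hU : S ⋖ U) (hV : S ⋖ V) :
    Submodule R (Module.End B S) where
  carrier := {d | ∃ φ : U →ₗ[B] V, ∀ s, φ (hU.incl s) = hV.incl (d s)}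
  add_mem' := by
    rintro _ _ ⟨φ, hφ⟩ ⟨ψ, hψ⟩
    exact ⟨φ + ψ, fun s ↦ by simp [hφ, hψ]⟩
  zero_mem' := ⟨0, fun s ↦ by simp⟩
  smul_mem' := by
    rintro r _ ⟨φ, hφ⟩
    exact ⟨r • φ, fun s ↦ by rw [LinearMap.smul_apply, hφ]; rfl⟩

namespace IsEssentialSimple

variable {S U V : Submodule B M} (hS : IsEssentialSimple S)
include hS

theorem exists_mem_extendableEnd (hU : S ⋖ U) (hV : S ⋖ V) (φ : U →ₗ[B] V) :
    ∃ d ∈ extendableEnd R hU hV, ∀ s, φ (hU.incl s) = hV.incl (d s) := by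
  have h : ∀ s, φ (hU.incl s) =
      hV.incl ((V.subtype ∘ₗ φ ∘ₗ hU.incl).codRestrict S (hS.apply_mem _) s) :=
    fun s ↦ Subtype.ext rfl
  exact ⟨_, ⟨φ, h⟩, h⟩

theorem length_extendableEnd_le (hU : S ⋖ U) (hV : S ⋖ V) :
    Module.length R (extendableEnd R hU hV) ≤ Module.length R (extendableEnd R hV hU) := by
  have := hS.isSimpleModule
  by_cases h0 : extendableEnd R hU hV = ⊥
  · rw [h0, Module.length_bot]
    exact zero_le
  obtain ⟨d, ⟨φ, hφ⟩, hd⟩ := Submodule.exists_mem_ne_zero_of_ne_bot h0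
  obtain ⟨s, hs⟩ : ∃ s, d s ≠ 0 := by
    by_contra! h
    exact hd (LinearMap.ext h)
  have hne : φ (hU.incl s) ≠ 0 := by
    rw [hφ]
    exact fun h ↦ hs (Submodule.inclusion_injective _ (h.trans (map_zero _).symm))
  have hbij := hS.bijective_of_apply_ne_zero hU φ (length_of_covBy hV).le s hne
  let e := LinearEquiv.ofBijective φ hbij
  obtain ⟨t, ⟨θ, hθ⟩, ht⟩ := hS.exists_mem_extendableEnd R hV hU e.symm.toLinearMap
  have htd : ∀ s, t (d s) = s := fun s ↦ by
    have h := ht (d s)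
    rw [← hφ] at h
    exact Submodule.inclusion_injective _ (h.symm.trans (e.symm_apply_apply _))
  have hts : Function.Surjective t := fun s ↦ ⟨d s, htd s⟩
  have hti : Function.Injective t := by
    refine LinearMap.injective_of_ne_zero ?_
    rintro rfl
    obtain ⟨s, hs⟩ := hS.exists_ne_zero
    exact hs (htd s).symm
  let F : Module.End B S →ₗ[R] Module.End B S :=
    LinearMap.mulRight R t ∘ₗ LinearMap.mulLeft R t
  have hF : ∀ x ∈ extendableEnd R hU hV, F x ∈ extendableEnd R hV hU := by
    rintro x ⟨ψ, hψ⟩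
    exact ⟨θ ∘ₗ ψ ∘ₗ θ, fun s ↦ by
      rw [LinearMap.comp_apply, LinearMap.comp_apply, hθ, hψ, hθ]; rfl⟩
  have hFi : Function.Injective F := by
    intro x y hxy
    refine LinearMap.ext fun s ↦ ?_
    obtain ⟨s, rfl⟩ := hts s
    exact hti (LinearMap.congr_fun hxy s)
  exact Module.length_le_of_injective (F.restrict hF) fun x y hxy ↦
    Subtype.ext (hFi (congrArg Subtype.val hxy))

end IsEssentialSimple

/-- Three submodules `U₁`, `U₂`, `U₃` covering an essential simple submodule `S`, independent
modulo `S`. -/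
structure IsCoveringTriple (S U₁ U₂ U₃ : Submodule B M) : Prop extends IsEssentialSimple S where
  covBy₁ : S ⋖ U₁
  covBy₂ : S ⋖ U₂
  covBy₃ : S ⋖ U₃
  mem_of_add_mem : ∀ u₁ ∈ U₁, ∀ u₂ ∈ U₂, ∀ u₃ ∈ U₃, u₁ + u₂ + u₃ ∈ S →
    u₁ ∈ S ∧ u₂ ∈ S ∧ u₃ ∈ S

namespace IsCoveringTriple

variable {S U₁ U₂ U₃ : Submodule B M} (h : IsCoveringTriple S U₁ U₂ U₃)
include h

theorem length_add_le : Module.length R (extendableEnd R h.covBy₃ h.covBy₁) +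
    (Module.length R (extendableEnd R h.covBy₃ h.covBy₂) +
      Module.length R (extendableEnd R h.covBy₃ h.covBy₃)) ≤ Module.length R (Module.End B S) := by
  rw [← Module.length_prod, ← Module.length_prod]
  let F : extendableEnd R h.covBy₃ h.covBy₁ × extendableEnd R h.covBy₃ h.covBy₂ ×
      extendableEnd R h.covBy₃ h.covBy₃ →ₗ[R] Module.End B S :=
    (Submodule.subtype _).coprod ((Submodule.subtype _).coprod (Submodule.subtype _))
  refine Module.length_le_of_injective F ?_
  rw [injective_iff_map_eq_zero]
  rintro ⟨⟨d₁, φ₁, h₁⟩, ⟨d₂, φ₂, h₂⟩, ⟨d₃, φ₃, h₃⟩⟩ h0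
  have h0' : ∀ s, d₁ s + (d₂ s + d₃ s) = 0 := LinearMap.congr_fun h0
  have hmem := h.apply_mem_of_eq_zero h.covBy₃
    (U₁.subtype ∘ₗ φ₁ + U₂.subtype ∘ₗ φ₂ + U₃.subtype ∘ₗ φ₃) (fun s ↦ by
      simpa [h₁, h₂, h₃, add_assoc] using congrArg Subtype.val (h0' s))
  have hmem' := fun u ↦ h.mem_of_add_mem _ (φ₁ u).2 _ (φ₂ u).2 _ (φ₃ u).2 (hmem u)
  have e₁ : d₁ = 0 := LinearMap.ext fun s ↦ Subtype.ext (by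
    simpa [h₁] using h.apply_eq_zero_of_mem h.covBy₃ (U₁.subtype ∘ₗ φ₁) (fun u ↦ (hmem' u).1) s)
  have e₂ : d₂ = 0 := LinearMap.ext fun s ↦ Subtype.ext (by
    simpa [h₂] using h.apply_eq_zero_of_mem h.covBy₃ (U₂.subtype ∘ₗ φ₂) (fun u ↦ (hmem' u).2.1) s)
  have e₃ : d₃ = 0 := LinearMap.ext fun s ↦ Subtype.ext (by
    simpa [h₃] using h.apply_eq_zero_of_mem h.covBy₃ (U₃.subtype ∘ₗ φ₃) (fun u ↦ (hmem' u).2.2) s)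
  subst e₁ e₂ e₃
  rfl

theorem exists_notMem_extendableEnd_sup (hfin : Module.length R (Module.End B S) ≠ ⊤) :
    ∃ x, x ∉ extendableEnd R h.covBy₁ h.covBy₃ ⊔ extendableEnd R h.covBy₂ h.covBy₃ := by
  by_contra! hx
  let F : extendableEnd R h.covBy₁ h.covBy₃ × extendableEnd R h.covBy₂ h.covBy₃ →ₗ[R]
      Module.End B S := (Submodule.subtype _).coprod (Submodule.subtype _)
  have hF : Function.Surjective F := fun x ↦ by
    obtain ⟨y, hy, z, hz, rfl⟩ := Submodule.mem_sup.1 (hx x)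
    exact ⟨(⟨y, hy⟩, ⟨z, hz⟩), rfl⟩
  have hle : Module.length R (Module.End B S) ≤
      Module.length R (extendableEnd R h.covBy₁ h.covBy₃ × extendableEnd R h.covBy₂ h.covBy₃) :=
    Module.length_le_of_surjective F hF
  rw [Module.length_prod] at hle
  have hle' := hle.trans (add_le_add (h.length_extendableEnd_le R h.covBy₁ h.covBy₃)
    (h.length_extendableEnd_le R h.covBy₂ h.covBy₃))
  have hlt := (h.length_add_le R).trans hle'
  rw [← add_assoc] at hlt
  have hsum : Module.length R (extendableEnd R h.covBy₃ h.covBy₁) +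
      Module.length R (extendableEnd R h.covBy₃ h.covBy₂) ≠ ⊤ := by
    refine ne_top_of_le_ne_top hfin (le_trans ?_ (h.length_add_le R))
    rw [← add_assoc]
    exact le_self_add
  have h0 := ENat.eq_zero_of_add_le_left hsum hlt
  rw [Module.length_eq_zero_iff] at h0
  obtain ⟨s, hs⟩ := h.exists_ne_zero
  have h1 : (1 : Module.End B S) ∈ extendableEnd R h.covBy₃ h.covBy₃ :=
    ⟨LinearMap.id, fun s ↦ rfl⟩
  have h10 : (1 : Module.End B S) = 0 := congrArg Subtype.val
    (Subsingleton.elim (⟨1, h1⟩ : extendableEnd R h.covBy₃ h.covBy₃) 0)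
  exact hs (LinearMap.congr_fun h10 s)

theorem not_forall_apply_eq (φ : U₁ →ₗ[B] U₂) :
    ¬ ∀ s, φ (h.covBy₁.incl s) = h.covBy₂.incl s := by
  intro hφ
  have hmem := h.apply_mem_of_eq_zero h.covBy₁ (U₁.subtype - U₂.subtype ∘ₗ φ)
    (fun s ↦ by simp [hφ])
  obtain ⟨u, hu, huS⟩ := SetLike.exists_of_lt h.covBy₁.lt
  refine huS (h.mem_of_add_mem u hu (-φ ⟨u, hu⟩) (neg_mem (φ ⟨u, hu⟩).2) 0 (zero_mem _) ?_).1
  simpa [sub_eq_add_neg] using hmem ⟨u, hu⟩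

/-- The skew diagonal `{(s, -s, x s)}` in `U₁ × U₂ × U₃`. -/
def skewDiagonal (x : Module.End B S) : S →ₗ[B] U₁ × U₂ × U₃ :=
  h.covBy₁.incl.prod ((-h.covBy₂.incl).prod (h.covBy₃.incl ∘ₗ x))

theorem apply_eq_zero_of_length_le_two {x : Module.End B S}
    (hx : x ∉ extendableEnd R h.covBy₁ h.covBy₃ ⊔ extendableEnd R h.covBy₂ h.covBy₃)
    (g : U₁ × U₂ × U₃ →ₗ[B] X) (hX : Module.length B X ≤ 2)
    (hg : ∀ s, g (h.skewDiagonal x s) = 0) (s₁ s₂ s₃ : S) :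
    g (h.covBy₁.incl s₁, h.covBy₂.incl s₂, h.covBy₃.incl s₃) = 0 := by
  let g₁ := g ∘ₗ LinearMap.inl B U₁ (U₂ × U₃)
  let g₂ := g ∘ₗ LinearMap.inr B U₁ (U₂ × U₃) ∘ₗ LinearMap.inl B U₂ U₃
  let g₃ := g ∘ₗ LinearMap.inr B U₁ (U₂ × U₃) ∘ₗ LinearMap.inr B U₂ U₃
  have hsum : ∀ u₁ u₂ u₃, g (u₁, u₂, u₃) = g₁ u₁ + g₂ u₂ + g₃ u₃ := fun u₁ u₂ u₃ ↦ by
    simp [g₁, g₂, g₃, ← map_add]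
  have hg' : ∀ s, g₁ (h.covBy₁.incl s) - g₂ (h.covBy₂.incl s) + g₃ (h.covBy₃.incl (x s)) = 0 := by
    intro s
    rw [← hg s, skewDiagonal]
    simp [hsum, sub_eq_add_neg]
  have h₃ : ∀ s, g₃ (h.covBy₃.incl s) = 0 := by
    by_contra! hne
    obtain ⟨s, hs⟩ := hne
    let e := LinearEquiv.ofBijective g₃ (h.bijective_of_apply_ne_zero h.covBy₃ g₃ hX s hs)
    obtain ⟨d₁, hd₁, hd₁'⟩ :=
      h.exists_mem_extendableEnd R h.covBy₁ h.covBy₃ (e.symm.toLinearMap ∘ₗ g₁)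
    obtain ⟨d₂, hd₂, hd₂'⟩ :=
      h.exists_mem_extendableEnd R h.covBy₂ h.covBy₃ (e.symm.toLinearMap ∘ₗ g₂)
    refine hx (Submodule.mem_sup.2 ⟨-d₁, neg_mem hd₁, d₂, hd₂, LinearMap.ext fun s ↦ ?_⟩)
    apply Submodule.inclusion_injective h.covBy₃.le
    rw [LinearMap.add_apply, LinearMap.neg_apply, map_add, map_neg, ← hd₁', ← hd₂']
    apply e.injective
    have hx₃ : e (h.covBy₃.incl (x s)) = g₂ (h.covBy₂.incl s) - g₁ (h.covBy₁.incl s) := by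
      have hs0 := hg' s
      rw [add_comm, add_eq_zero_iff_eq_neg, neg_sub] at hs0
      exact hs0
    rw [hx₃]
    simp only [map_add, map_neg, LinearMap.comp_apply, LinearEquiv.coe_coe, e.apply_symm_apply]
    exact neg_add_eq_sub _ _
  have h₁₂ : ∀ s, g₁ (h.covBy₁.incl s) = g₂ (h.covBy₂.incl s) := fun s ↦ by
    simpa [h₃, sub_eq_zero] using hg' s
  have h₂ : ∀ s, g₂ (h.covBy₂.incl s) = 0 := by
    by_contra! hne
    obtain ⟨s, hs⟩ := hne
    let e := LinearEquiv.ofBijective g₂ (h.bijective_of_apply_ne_zero h.covBy₂ g₂ hX s hs)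
    exact h.not_forall_apply_eq (e.symm.toLinearMap ∘ₗ g₁) fun s ↦
      e.symm_apply_eq.2 (h₁₂ s)
  rw [hsum, h₃, h₂, h₁₂, h₂]
  simp

end IsCoveringTriple

end EssentialSimple

section LocalCriteria

variable {A M : Type*} [Ring A] [AddCommGroup M] [Module A M]

theorem moduleLength_eq_coe_length : moduleLength A M = (Module.length A M : WithBot ℕ∞) :=
  (Module.coe_length A M).symm

theorem radPow_one_eq_jacobson : radPow A M 1 = Module.jacobson A M :=
  Module.map_jacobson_of_bijective (f := (⊤ : Submodule A M).subtype)
    ⟨Submodule.subtype_injective _, fun x ↦ ⟨⟨x, trivial⟩, rfl⟩⟩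

theorem radPow_le_jacobson {k : ℕ} (hk : 1 ≤ k) : radPow A M k ≤ Module.jacobson A M := by
  induction k, hk using Nat.le_induction with
  | base => exact radPow_one_eq_jacobson.le
  | succ k _ ih => exact (Submodule.map_subtype_le _ _).trans ih

theorem isLocalModule_of_isUniserialModule_quotient [Nontrivial M] [Module.Finite A M]
    {K : Submodule A M} (hK : K ≤ Module.jacobson A M) (h : IsUniserialModule A (M ⧸ K)) :
    IsLocalModule A M := by
  obtain ⟨N, hN, -⟩ := (eq_top_or_exists_le_coatom (⊥ : Submodule A M)).resolve_left bot_ne_top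
  refine ⟨N, hN, fun P hP ↦ ?_⟩
  have hKN : ∀ Q : Submodule A M, IsCoatom Q → (Q.map K.mkQ).comap K.mkQ = Q := fun Q hQ ↦ by
    rw [Submodule.comap_map_mkQ, sup_eq_right]
    exact hK.trans (sInf_le hQ)
  rcases h (N.map K.mkQ) (P.map K.mkQ) with hle | hle <;>
  · have h' := Submodule.comap_mono (f := K.mkQ) hle
    rw [hKN N hN, hKN P hP] at h'
    first
    | exact ((hN.le_iff.1 h').resolve_left hP.1)
    | exact ((hP.le_iff.1 h').resolve_left hN.1).symm

theorem IsFactorSerial.isLocalModule [Nontrivial M] [Module.Finite A M] {i l : ℕ}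
    (h : IsFactorSerial A M i) (hl : moduleLength A M = l) (hil : i < l) : IsLocalModule A M := by
  rcases h with ⟨-, h⟩ | ⟨-, -, k, hk, -, h, -⟩
  · exact isLocalModule_of_isUniserialModule_quotient bot_le fun N P ↦ by
      have hb : Function.Surjective (⊥ : Submodule A M).mkQ := Submodule.mkQ_surjective _
      rw [← Submodule.map_comap_eq_of_surjective hb N, ← Submodule.map_comap_eq_of_surjective hb P]
      exact (h _ _).imp Submodule.map_mono Submodule.map_mono
  · have hkl : k = l := by exact_mod_cast hk.symm.trans hl
    subst hkl
    exact isLocalModule_of_isUniserialModule_quotient (radPow_le_jacobson (by omega)) h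

/-- A submodule killed by the Jacobson radical lies in an essential simple submodule. -/
theorem IsEssentialSimple.mem_of_jacobson_smul_eq_zero [IsArtinianRing A] {S : Submodule A M}
    (hS : IsEssentialSimple S) (m : M) (hm : ∀ r ∈ Ring.jacobson A, r • m = 0) : m ∈ S := by
  have hss : IsSemisimpleModule A (A ⧸ Ring.jacobson A) :=
    (IsArtinian.isSemisimpleModule_iff_jacobson _ _).2 (Module.jacobson_quotient_jacobson A A)
  let f : A ⧸ Ring.jacobson A →ₗ[A] M :=
    (Ring.jacobson A).liftQ (LinearMap.toSpanSingleton A M m) hm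
  have := IsSemisimpleModule.range f
  have hmf : m ∈ LinearMap.range f := ⟨Submodule.Quotient.mk 1, one_smul A m⟩
  by_cases hbot : LinearMap.range f = ⊥
  · rw [hbot] at hmf
    rw [(Submodule.mem_bot A).1 hmf]
    exact zero_mem _
  have hSf := hS.le_of_ne_bot _ hbot
  obtain ⟨C, hC⟩ := exists_isCompl (S.comap (LinearMap.range f).subtype)
  have hC0 : C = ⊥ := by
    by_contra h0
    have hSC := hS.le_of_ne_bot (C.map (LinearMap.range f).subtype) fun h ↦ h0 <|
      Submodule.map_injective_of_injective (Submodule.subtype_injective _)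
        (h.trans (Submodule.map_bot _).symm)
    obtain ⟨s, hs⟩ := hS.exists_ne_zero
    obtain ⟨c, hc, hcs⟩ := hSC s.2
    have hcS : c ∈ S.comap (LinearMap.range f).subtype := by
      rw [Submodule.mem_comap, hcs]
      exact s.2
    have hc0 : c = 0 := Submodule.disjoint_def.1 hC.disjoint c hcS hc
    rw [hc0] at hcs
    exact hs (Subtype.ext hcs.symm)
  have htop := hC.sup_eq_top
  rw [hC0, sup_bot_eq] at htop
  have hmem : (⟨m, hmf⟩ : LinearMap.range f) ∈ S.comap (LinearMap.range f).subtype := by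
    rw [htop]
    trivial
  exact hmem

end LocalCriteria

namespace IsCoveringTriple

open Module

variable {B M : Type*} [Ring B] [AddCommGroup M] [Module B M]
variable {S U₁ U₂ U₃ : Submodule B M} (h : IsCoveringTriple S U₁ U₂ U₃)
include h

/-- The amalgamation of `U₁`, `U₂`, `U₃` along a skew diagonal copy of `S`. -/
abbrev Amalgam (x : Module.End B S) : Type _ :=
  (U₁ × U₂ × U₃) ⧸ LinearMap.range (h.skewDiagonal x)

theorem length_amalgam (x : Module.End B S) : Module.length B (h.Amalgam x) = 5 := by
  have := h.isSimpleModule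
  have hinj : Function.Injective (h.skewDiagonal x) := fun s t hst ↦
    Submodule.inclusion_injective h.covBy₁.le (congrArg Prod.fst hst)
  have hl := Module.length_eq_add_of_exact (h.skewDiagonal x)
    (LinearMap.range (h.skewDiagonal x)).mkQ hinj (Submodule.mkQ_surjective _)
    (LinearMap.exact_map_mkQ_range _)
  rw [Module.length_prod, Module.length_prod, length_of_covBy h.covBy₁, length_of_covBy h.covBy₂,
    length_of_covBy h.covBy₃, Module.length_eq_one] at hl
  have h6 : (1 : ℕ∞) + 5 = 2 + (2 + 2) := by norm_num
  rw [← h6] at hl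
  exact (ENat.add_right_injective_of_ne_top ENat.one_ne_top hl).symm

theorem not_isLocalModule_amalgam (x : Module.End B S) : ¬ IsLocalModule B (h.Amalgam x) := by
  have s₁ := (covBy_iff_quot_is_simple h.covBy₁.le).1 h.covBy₁
  have s₂ := (covBy_iff_quot_is_simple h.covBy₂.le).1 h.covBy₂
  let q₁ := (Submodule.comap U₁.subtype S).mkQ ∘ₗ LinearMap.fst B U₁ (U₂ × U₃)
  let q₂ := (Submodule.comap U₂.subtype S).mkQ ∘ₗ LinearMap.fst B U₂ U₃ ∘ₗ
    LinearMap.snd B U₁ (U₂ × U₃)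
  let p₁ : h.Amalgam x →ₗ[B] _ := (LinearMap.range (h.skewDiagonal x)).liftQ q₁ (by
    rintro _ ⟨s, rfl⟩
    exact (Submodule.Quotient.mk_eq_zero _).2 s.2)
  let p₂ : h.Amalgam x →ₗ[B] _ := (LinearMap.range (h.skewDiagonal x)).liftQ q₂ (by
    rintro _ ⟨s, rfl⟩
    exact (Submodule.Quotient.mk_eq_zero _).2 (neg_mem s.2))
  have hp₁ : Function.Surjective p₁ := fun y ↦ by
    obtain ⟨u, rfl⟩ := Submodule.mkQ_surjective _ y
    exact ⟨Submodule.Quotient.mk (u, 0, 0), rfl⟩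
  have hp₂ : Function.Surjective p₂ := fun y ↦ by
    obtain ⟨u, rfl⟩ := Submodule.mkQ_surjective _ y
    exact ⟨Submodule.Quotient.mk (0, u, 0), rfl⟩
  have c₁ : IsCoatom (LinearMap.ker p₁) := isSimpleModule_iff_isCoatom.1
    (IsSimpleModule.congr (p₁.quotKerEquivOfSurjective hp₁))
  have c₂ : IsCoatom (LinearMap.ker p₂) := isSimpleModule_iff_isCoatom.1
    (IsSimpleModule.congr (p₂.quotKerEquivOfSurjective hp₂))
  intro hloc
  obtain ⟨u, hu, huS⟩ := SetLike.exists_of_lt h.covBy₁.lt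
  have hmem : (Submodule.Quotient.mk (⟨u, hu⟩, 0, 0) : h.Amalgam x) ∈ LinearMap.ker p₂ :=
    (Submodule.Quotient.mk_eq_zero (Submodule.comap U₂.subtype S)).2 (zero_mem _)
  rw [hloc.unique c₂ c₁] at hmem
  exact huS ((Submodule.Quotient.mk_eq_zero (Submodule.comap U₁.subtype S)).1 hmem)

variable (R : Type*) [CommRing R] [Algebra R B] [Module R M] [IsScalarTower R B M]

omit h in
theorem jacobson_smul_mem {U : Submodule B M} (hU : S ⋖ U) {r : B} (hr : r ∈ Ring.jacobson B)
    (u : U) : r • (u : M) ∈ S := by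
  have := (covBy_iff_quot_is_simple hU.le).1 hU
  have hann := Module.mem_annihilator.1 (IsSemisimpleModule.jacobson_le_annihilator B
    (U ⧸ Submodule.comap U.subtype S) hr) (Submodule.Quotient.mk u)
  exact (Submodule.Quotient.mk_eq_zero (Submodule.comap U.subtype S)).1 hann

theorem eq_bot_of_length_le_two [IsArtinianRing B] {x : Module.End B S}
    (hx : x ∉ extendableEnd R h.covBy₁ h.covBy₃ ⊔ extendableEnd R h.covBy₂ h.covBy₃)
    {X Y : Submodule B (h.Amalgam x)} (hXY : IsCompl X Y) (hX : Module.length B X ≤ 2) :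
    X = ⊥ := by
  rw [Submodule.eq_bot_iff]
  intro c hc
  let g := X.projectionOnto Y hXY ∘ₗ (LinearMap.range (h.skewDiagonal x)).mkQ
  have hg := h.apply_eq_zero_of_length_le_two R hx g hX (fun s ↦ by
    have h0 : (LinearMap.range (h.skewDiagonal x)).mkQ (h.skewDiagonal x s) = 0 :=
      (Submodule.Quotient.mk_eq_zero _).2 ⟨s, rfl⟩
    rw [LinearMap.comp_apply, h0, map_zero])
  have hgS : ∀ (u₁ : U₁) (u₂ : U₂) (u₃ : U₃), (u₁ : M) ∈ S → (u₂ : M) ∈ S → (u₃ : M) ∈ S → g (u₁, u₂, u₃) = 0 :=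
    fun u₁ u₂ u₃ h₁ h₂ h₃ ↦ hg ⟨u₁, h₁⟩ ⟨u₂, h₂⟩ ⟨u₃, h₃⟩
  obtain ⟨⟨u₁, u₂, u₃⟩, rfl⟩ := Submodule.mkQ_surjective _ c
  have hgc : (g (u₁, u₂, u₃) : h.Amalgam x) =
      (LinearMap.range (h.skewDiagonal x)).mkQ (u₁, u₂, u₃) := by
    exact congrArg Subtype.val (Submodule.projectionOnto_apply_of_mem_left hXY hc)
  have hr : ∀ r ∈ Ring.jacobson B, ∃ s, h.skewDiagonal x s = r • (u₁, u₂, u₃) := fun r hr ↦ by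
    have h0 : g (r • (u₁, u₂, u₃)) = 0 := hgS _ _ _ (jacobson_smul_mem h.covBy₁ hr u₁)
      (jacobson_smul_mem h.covBy₂ hr u₂) (jacobson_smul_mem h.covBy₃ hr u₃)
    have h1 : (LinearMap.range (h.skewDiagonal x)).mkQ (r • (u₁, u₂, u₃)) = 0 := by
      rw [map_smul, ← hgc, ← Submodule.coe_smul, ← map_smul, h0, Submodule.coe_zero]
    exact (Submodule.Quotient.mk_eq_zero _).1 h1
  have h₁₂ : (u₁ : M) + u₂ ∈ S := h.mem_of_jacobson_smul_eq_zero _ fun r hrJ ↦ by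
    obtain ⟨s, hs⟩ := hr r hrJ
    have e₁ : (s : M) = r • (u₁ : M) := congrArg (fun p ↦ (p.1 : M)) hs
    have e₂ : -(s : M) = r • (u₂ : M) := congrArg (fun p ↦ (p.2.1 : M)) hs
    rw [smul_add, ← e₁, ← e₂, add_neg_cancel]
  obtain ⟨h₁, h₂, -⟩ := h.mem_of_add_mem _ u₁.2 _ u₂.2 0 (zero_mem _) (by simpa using h₁₂)
  have := h.isSimpleModule
  have h₃ : (u₃ : M) ∈ S := h.mem_of_jacobson_smul_eq_zero _ fun r hrJ ↦ by
    obtain ⟨s, hs⟩ := hr r hrJ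
    have e₁ : (s : M) = r • (u₁ : M) := congrArg (fun p ↦ (p.1 : M)) hs
    have e₃ : (x s : M) = r • (u₃ : M) := congrArg (fun p ↦ (p.2.2 : M)) hs
    have e₀ : r • (⟨u₁, h₁⟩ : S) = 0 := Module.mem_annihilator.1
      (IsSemisimpleModule.jacobson_le_annihilator B S hrJ) _
    have hs0 : s = 0 := Subtype.ext (e₁.trans (congrArg Subtype.val e₀))
    rw [← e₃, hs0, map_zero, Submodule.coe_zero]
  rw [← hgc, hgS _ _ _ h₁ h₂ h₃, Submodule.coe_zero]

theorem isIndecModule_amalgam [IsArtinianRing B] {x : Module.End B S}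
    (hx : x ∉ extendableEnd R h.covBy₁ h.covBy₃ ⊔ extendableEnd R h.covBy₂ h.covBy₃) :
    IsIndecModule B (h.Amalgam x) := by
  have hl := h.length_amalgam x
  have hpos : 0 < Module.length B (h.Amalgam x) := by
    rw [hl]
    norm_num
  refine ⟨Module.length_pos_iff.1 hpos, fun X Y hXY ↦ ?_⟩
  have hsum := (Submodule.prodEquivOfIsCompl X Y hXY).length_eq
  rw [Module.length_prod, hl] at hsum
  rcases le_or_gt (Module.length B X) 2 with hX | hX
  · exact Or.inl (h.eq_bot_of_length_le_two R hx hXY hX)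
  rcases le_or_gt (Module.length B Y) 2 with hY | hY
  · exact Or.inr (h.eq_bot_of_length_le_two R hx hXY.symm hY)
  have h3 := add_le_add (Order.add_one_le_of_lt hX) (Order.add_one_le_of_lt hY)
  rw [hsum] at h3
  norm_num at h3

end IsCoveringTriple

section Existence

open Module

variable {B M : Type*} [Ring B] [AddCommGroup M] [Module B M]

theorem isEssentialSimple_of_isSemisimpleModule_quotient {S : Submodule B M}
    (hS : IsSimpleModule B S) [IsSemisimpleModule B (M ⧸ S)] (hind : IsIndecModule B M) :
    IsEssentialSimple S := by
  refine ⟨hS, fun C hC ↦ ?_⟩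
  have hat : IsAtom S := isSimpleModule_iff_isAtom.1 hS
  by_contra hSC
  have hdisj : S ⊓ C = ⊥ := (hat.le_iff.1 inf_le_left).resolve_right fun h ↦ hSC (inf_eq_left.1 h)
  obtain ⟨D, hD⟩ := exists_isCompl (C.map S.mkQ)
  have hcompl : IsCompl (D.comap S.mkQ) C := by
    constructor
    · rw [Submodule.disjoint_def]
      intro y hyD hyC
      have hy0 : S.mkQ y = 0 := Submodule.disjoint_def.1 hD.disjoint _ ⟨y, hyC, rfl⟩ hyD
      have hyS : y ∈ S := (Submodule.Quotient.mk_eq_zero _).1 hy0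
      exact (Submodule.mem_bot B).1 (hdisj ▸ ⟨hyS, hyC⟩)
    · rw [codisjoint_iff, Submodule.eq_top_iff']
      intro y
      obtain ⟨_, ⟨c, hc, rfl⟩, d, hd, hy⟩ := Submodule.mem_sup.1
        (hD.sup_eq_top ▸ trivial : S.mkQ y ∈ C.map S.mkQ ⊔ D)
      refine Submodule.mem_sup.2 ⟨y - c, ?_, c, hc, sub_add_cancel y c⟩
      rw [Submodule.mem_comap, map_sub, ← hy, add_sub_cancel_left]
      exact hd
  rcases hind.2 _ _ hcompl with h | h
  · refine hat.1 (le_bot_iff.1 (h ▸ fun s hs ↦ ?_))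
    rw [Submodule.mem_comap, Submodule.mkQ_apply, (Submodule.Quotient.mk_eq_zero _).2 hs]
    exact zero_mem _
  · exact hC h

theorem covBy_comap_mkQ {S : Submodule B M} {T : Submodule B (M ⧸ S)} (hT : IsAtom T) :
    S ⋖ T.comap S.mkQ := by
  have hcm : (T.comap S.mkQ).map S.mkQ = T :=
    Submodule.map_comap_eq_of_surjective (Submodule.mkQ_surjective _) _
  refine ⟨lt_of_le_of_ne (Submodule.le_comap_mkQ _ _) fun h ↦ hT.1 ?_, fun C hSC hC ↦ ?_⟩
  · rw [← hcm, ← h, Submodule.mkQ_map_self]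
  · have hCm : (C.map S.mkQ).comap S.mkQ = C := by
      rw [Submodule.comap_map_mkQ, sup_eq_right]
      exact hSC.le
    rcases hT.le_iff.1 ((Submodule.map_mono hC.le).trans hcm.le) with h | h
    · rw [h, ← LinearMap.ker, Submodule.ker_mkQ] at hCm
      exact hSC.ne hCm
    · rw [h] at hCm
      exact hC.ne hCm.symm

theorem length_sup_le (N P : Submodule B M) :
    Module.length B ↥(N ⊔ P) ≤ Module.length B N + Module.length B P := by
  rw [← Module.length_prod]
  refine Module.length_le_of_surjective (((Submodule.inclusion le_sup_left).coprod
    (Submodule.inclusion le_sup_right) : N × P →ₗ[B] ↥(N ⊔ P))) ?_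
  rintro ⟨y, hy⟩
  obtain ⟨n, hn, p, hp, rfl⟩ := Submodule.mem_sup.1 hy
  exact ⟨(⟨n, hn⟩, ⟨p, hp⟩), rfl⟩

theorem exists_isAtom_disjoint [IsSemisimpleModule B M] {K : Submodule B M}
    (hK : Module.length B K < Module.length B M) :
    ∃ T : Submodule B M, IsAtom T ∧ Disjoint K T := by
  have hne : K ≠ ⊤ := by
    rintro rfl
    rw [Module.length_top] at hK
    exact hK.false
  by_contra! h
  refine hne (top_le_iff.1 ?_)
  rw [← sSup_atoms_eq_top]
  refine sSup_le fun T hT ↦ ?_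
  by_contra hTK
  refine h T hT (disjoint_iff.2 ?_)
  exact (hT.le_iff.1 inf_le_right).resolve_right fun h ↦ hTK (inf_eq_right.1 h)

theorem exists_isCoveringTriple {S : Submodule B M} (hS : IsSimpleModule B S)
    [IsSemisimpleModule B (M ⧸ S)] (hind : IsIndecModule B M)
    (hl : Module.length B (M ⧸ S) = 3) : ∃ U₁ U₂ U₃, IsCoveringTriple S U₁ U₂ U₃ := by
  have hone : ∀ T : Submodule B (M ⧸ S), IsAtom T → Module.length B T = 1 := fun T hT ↦
    Module.length_eq_one_iff.2 (isSimpleModule_iff_isAtom.2 hT)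
  obtain ⟨T₁, hT₁, -⟩ := exists_isAtom_disjoint (K := (⊥ : Submodule B (M ⧸ S)))
    (by rw [hl, Module.length_bot]; norm_num)
  obtain ⟨T₂, hT₂, hd₂⟩ := exists_isAtom_disjoint (K := T₁)
    (by rw [hl, hone _ hT₁]; norm_num)
  obtain ⟨T₃, hT₃, hd₃⟩ := exists_isAtom_disjoint (K := T₁ ⊔ T₂)
    (by
      refine (length_sup_le T₁ T₂).trans_lt ?_
      rw [hl, hone _ hT₁, hone _ hT₂]
      norm_num)
  refine ⟨T₁.comap S.mkQ, T₂.comap S.mkQ, T₃.comap S.mkQ,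
    { toIsEssentialSimple := isEssentialSimple_of_isSemisimpleModule_quotient hS hind
      covBy₁ := covBy_comap_mkQ hT₁
      covBy₂ := covBy_comap_mkQ hT₂
      covBy₃ := covBy_comap_mkQ hT₃
      mem_of_add_mem := ?_ }⟩
  intro u₁ h₁ u₂ h₂ u₃ h₃ hS
  have hmem : ∀ u, S.mkQ u = 0 ↔ u ∈ S := fun u ↦ Submodule.Quotient.mk_eq_zero _
  rw [← hmem, map_add, map_add] at hS
  have h₁₂ : S.mkQ u₁ + S.mkQ u₂ ∈ T₁ ⊔ T₂ := Submodule.add_mem_sup h₁ h₂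
  have e₃ : S.mkQ u₃ = 0 := Submodule.disjoint_def.1 hd₃ _ (by
    rw [eq_neg_of_add_eq_zero_right hS]
    exact neg_mem h₁₂) h₃
  rw [e₃, add_zero] at hS
  have e₂ : S.mkQ u₂ = 0 := Submodule.disjoint_def.1 hd₂ _ (by
    rw [eq_neg_of_add_eq_zero_right hS]
    exact neg_mem h₁) h₂
  rw [e₂, add_zero] at hS
  exact ⟨(hmem _).1 hS, (hmem _).1 e₂, (hmem _).1 e₃⟩

variable (R : Type*) [CommRing R] [IsArtinianRing R] [Algebra R B] [Module R M]
  [IsScalarTower R B M]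

theorem length_end_ne_top [Module.Finite R M] (S : Submodule B M) :
    Module.length R (Module.End B S) ≠ ⊤ := by
  have : Module.Finite R S :=
    inferInstanceAs (Module.Finite R (S.restrictScalars R))
  have : Module.Finite R (Module.End R S) := inferInstance
  let F : Module.End B S →ₗ[R] Module.End R S := LinearMap.restrictScalarsₗ R B S S R
  refine ne_top_of_le_ne_top (Module.length_ne_top (R := R) (M := Module.End R S))
    (Module.length_le_of_injective F (LinearMap.restrictScalars_injective R))

end Existence

theorem top_length_of_nonlocal_four_factor_serial
    (R : Type*) [CommRing R] [IsArtinianRing R]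
    (Λ : Type u) [Ring Λ] [Algebra R Λ] [Module.Finite R Λ]
    (hΛ : IsRightNNakayama Λ 4)
    (M : Type u) [AddCommGroup M] [Module Λᵐᵒᵖ M] [Module.Finite Λᵐᵒᵖ M]
    (hind : IsIndecModule Λᵐᵒᵖ M) (hfs : IsNFactorSerial Λᵐᵒᵖ M 4)
    (hnl : ¬ IsLocalModule Λᵐᵒᵖ M) :
    moduleLength Λᵐᵒᵖ (M ⧸ radPow Λᵐᵒᵖ M 1) = 2 := by
  have := hind.1
  have : Module.Finite R Λᵐᵒᵖ := Module.Finite.equiv (MulOpposite.opLinearEquiv R)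
  have : IsArtinianRing Λᵐᵒᵖ := IsArtinianRing.of_finite R Λᵐᵒᵖ
  let : Module R M := Module.compHom M (algebraMap R Λᵐᵒᵖ)
  have : IsScalarTower R Λᵐᵒᵖ M := ⟨fun r a m ↦ by
    rw [Algebra.smul_def, mul_smul]
    rfl⟩
  have : Module.Finite R M := Module.Finite.trans Λᵐᵒᵖ M
  rw [radPow_one_eq_jacobson, moduleLength_eq_coe_length]
  have hM : Module.length Λᵐᵒᵖ M = 4 := by
    obtain ⟨l, hl, h4, -⟩ := hfs.2.2
    have h4' : ¬ 4 < l := fun h ↦ hnl (IsFactorSerial.isLocalModule (Or.inr hfs) hl h)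
    obtain rfl : l = 4 := by omega
    rw [moduleLength_eq_coe_length] at hl
    exact WithBot.coe_injective hl
  have hsum := Module.length_eq_add_of_exact (Module.jacobson Λᵐᵒᵖ M).subtype
    (Module.jacobson Λᵐᵒᵖ M).mkQ (Submodule.subtype_injective _) (Submodule.mkQ_surjective _)
    (LinearMap.exact_subtype_mkQ _)
  rw [hM] at hsum
  have hss : IsSemisimpleModule Λᵐᵒᵖ (M ⧸ Module.jacobson Λᵐᵒᵖ M) :=
    (IsArtinian.isSemisimpleModule_iff_jacobson _ _).2 (Module.jacobson_quotient_jacobson _ _)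
  have hlt : Module.jacobson Λᵐᵒᵖ M < ⊤ := Module.jacobson_lt_top _ _
  generalize ha : Module.length Λᵐᵒᵖ (Module.jacobson Λᵐᵒᵖ M) = a at hsum
  generalize hb : Module.length Λᵐᵒᵖ (M ⧸ Module.jacobson Λᵐᵒᵖ M) = b at hsum ⊢
  have ha' : a ≠ ⊤ := by rintro rfl; simp at hsum
  have hb' : b ≠ ⊤ := by rintro rfl; simp at hsum
  lift a to ℕ using ha'
  lift b to ℕ using hb'
  have hab : 4 = a + b := by exact_mod_cast hsum
  have hb0 : b ≠ 0 := by
    rintro rfl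
    have h0 := Module.length_eq_zero_iff.1 hb
    exact hlt.ne (Submodule.Quotient.subsingleton_iff.1 h0)
  have hb1 : b ≠ 1 := by
    rintro rfl
    have hco := isSimpleModule_iff_isCoatom.1 (Module.length_eq_one_iff.1 hb)
    exact hnl ⟨_, hco, fun P hP ↦ (hco.le_iff.1 (sInf_le hP)).resolve_left hP.1⟩
  have ha0 : a ≠ 0 := by
    rintro rfl
    have h0 := (Submodule.subsingleton_iff_eq_bot).1 (Module.length_eq_zero_iff.1 ha)
    have : IsSemisimpleModule Λᵐᵒᵖ M := (IsArtinian.isSemisimpleModule_iff_jacobson _ _).2 h0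
    refine hfs.2.1 fun N P ↦ ?_
    obtain ⟨C, hC⟩ := exists_isCompl N
    rcases hind.2 N C hC with rfl | rfl
    · exact Or.inl bot_le
    · have hN := hC.sup_eq_top
      rw [sup_bot_eq] at hN
      exact Or.inr (hN ▸ le_top)
  have hb3 : b ≠ 3 := by
    rintro rfl
    obtain rfl : a = 1 := by omega
    obtain ⟨U₁, U₂, U₃, h⟩ := exists_isCoveringTriple (Module.length_eq_one_iff.1 ha) hind hb
    obtain ⟨x, hx⟩ := h.exists_notMem_extendableEnd_sup R (length_end_ne_top R _)
    have hN := h.isIndecModule_amalgam R hx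
    have := hN.1
    obtain ⟨i, -, hi, hser⟩ := hΛ.1 (ModuleCat.of Λᵐᵒᵖ (h.Amalgam x)) inferInstance hN
    refine h.not_isLocalModule_amalgam x (hser.isLocalModule (l := 5) ?_ (by omega))
    rw [moduleLength_eq_coe_length]
    exact congrArg _ (h.length_amalgam x)
  obtain rfl : b = 2 := by omega
  rfl
end
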